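/- arXiv:2504.00925 — 2 statements merged into one kernel-verified Lean document; each statement's English description precedes it below -/
import Mathlib

section
/- Let α ∈ ℝ be an irrational number that is algebraic over ℚ. Then for every δ > 0 there exists a constant C > 0 (depending on α and δ) such that |qα − p| > C·|q|^{−(1+δ)} for every q ∈ ℤ \ {0} and every p ∈ ℤ. -/
open Real

namespace RothTheorem

open MvPolynomial

section HasseDerivative

/-- Induction on multi-indices by adding one unit vector at a time. -/
lemma multiindex_induction {σ : Type*} {motive : (σ →₀ ℕ) → Prop} (zero : motive 0)
    (step : ∀ Δ h, motive Δ → motive (Δ + Finsupp.single h 1)) (Δ : σ →₀ ℕ) : motive Δ := by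
  classical
  have aux : ∀ f g : σ →₀ ℕ, motive g → motive (g + f) := by
    intro f
    induction f using Finsupp.induction_linear with
    | zero => intro g hg; simpa using hg
    | add f₁ f₂ h₁ h₂ => intro g hg; rw [← add_assoc]; exact h₂ _ (h₁ _ hg)
    | single a b =>
      induction b with
      | zero => intro g hg; simpa using hg
      | succ b ih =>
        intro g hg
        rw [Finsupp.single_add, ← add_assoc]
        exact step _ _ (ih g hg)
  simpa using aux Δ 0 zero

variable {σ : Type*} [Fintype σ]

/-- The product of binomial coefficients `∏ h, (I h + Δ h).choose (Δ h)`. -/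
def multichoose (I Δ : σ →₀ ℕ) : ℕ := ∏ h, (I h + Δ h).choose (Δ h)

lemma multichoose_zero (I : σ →₀ ℕ) : multichoose I 0 = 1 := by simp [multichoose]

lemma multichoose_le (I Δ : σ →₀ ℕ) : multichoose I Δ ≤ 2 ^ ∑ h, (I + Δ) h := by
  rw [multichoose, ← Finset.prod_pow_eq_pow_sum]
  exact Finset.prod_le_prod' fun h _ => Nat.choose_le_two_pow _ _

lemma multichoose_single_add (I Δ : σ →₀ ℕ) (h : σ) :
    multichoose (I + Finsupp.single h 1) Δ * (I h + 1) =
      (Δ h + 1) * multichoose I (Δ + Finsupp.single h 1) := by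
  classical
  unfold multichoose
  rw [← Finset.mul_prod_erase _ _ (Finset.mem_univ h), ← Finset.mul_prod_erase _ _ (Finset.mem_univ h)]
  have hrest : ∏ x ∈ Finset.univ.erase h, ((I + Finsupp.single h 1 : σ →₀ ℕ) x + Δ x).choose (Δ x) =
      ∏ x ∈ Finset.univ.erase h, (I x + (Δ + Finsupp.single h 1 : σ →₀ ℕ) x).choose
        ((Δ + Finsupp.single h 1 : σ →₀ ℕ) x) := by
    refine Finset.prod_congr rfl fun x hx => ?_
    have : h ≠ x := (Finset.ne_of_mem_erase hx).symm
    simp [this]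
  rw [hrest]
  have key : (I h + 1 + Δ h).choose (Δ h) * (I h + 1) =
      (Δ h + 1) * (I h + (Δ h + 1)).choose (Δ h + 1) := by
    have h1 := Nat.choose_succ_right_eq (I h + 1 + Δ h) (Δ h)
    rw [show I h + 1 + Δ h - Δ h = I h + 1 by omega] at h1
    rw [← h1, mul_comm, show I h + (Δ h + 1) = I h + 1 + Δ h by omega]
  simp only [Finsupp.coe_add, Pi.add_apply, Finsupp.single_eq_same]
  rw [mul_right_comm, key]
  ring

/-- The Hasse derivative `(1 / Δ!) ∂^Δ`. -/
noncomputable def hasse (Δ : σ →₀ ℕ) : MvPolynomial σ ℝ →ₗ[ℝ] MvPolynomial σ ℝ :=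
  (basisMonomials σ ℝ).constr ℝ fun e =>
    if Δ ≤ e then monomial (e - Δ) (multichoose (e - Δ) Δ : ℝ) else 0

lemma coeff_hasse (Δ I : σ →₀ ℕ) (P : MvPolynomial σ ℝ) :
    coeff I (hasse Δ P) = multichoose I Δ * coeff (I + Δ) P := by
  classical
  induction P using MvPolynomial.induction_on' with
  | monomial e c =>
    have h1 : (monomial e c : MvPolynomial σ ℝ) = c • basisMonomials σ ℝ e := by
      simp [coe_basisMonomials, smul_monomial]
    rw [h1, map_smul, hasse, Module.Basis.constr_basis, ← h1, coeff_smul, coeff_monomial]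
    split_ifs with h2 h3 h3
    · subst h3
      simp [mul_comm]
    · rw [coeff_monomial, if_neg]
      · simp
      · rintro rfl
        exact h3 (tsub_add_cancel_of_le h2).symm
    · exact absurd (h3 ▸ le_add_self) h2
    · simp
  | add p q hp hq => rw [map_add, coeff_add, hp, hq, coeff_add]; ring

@[simp] lemma hasse_zero (P : MvPolynomial σ ℝ) : hasse 0 P = P := by
  ext I
  simp [coeff_hasse, multichoose_zero]

lemma pderiv_hasse (Δ : σ →₀ ℕ) (h : σ) (P : MvPolynomial σ ℝ) :
    pderiv h (hasse Δ P) = ((Δ h : ℝ) + 1) • hasse (Δ + Finsupp.single h 1) P := by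
  ext I
  rw [coeff_pderiv, coeff_smul, coeff_hasse, coeff_hasse, smul_eq_mul]
  have := congrArg (Nat.cast : ℕ → ℝ) (multichoose_single_add I Δ h)
  push_cast at this
  rw [← mul_assoc, ← this, add_right_comm I, ← add_assoc]
  ring

lemma hasse_add_single (Δ : σ →₀ ℕ) (h : σ) (P : MvPolynomial σ ℝ) :
    hasse (Δ + Finsupp.single h 1) P = ((Δ h : ℝ) + 1)⁻¹ • pderiv h (hasse Δ P) := by
  rw [pderiv_hasse, smul_smul, inv_mul_cancel₀ (by positivity), one_smul]

lemma hasse_mul_of_pderiv_eq_zero {Δ : σ →₀ ℕ} {f g : MvPolynomial σ ℝ}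
    (hg : ∀ h ∈ Δ.support, pderiv h g = 0) : hasse Δ (f * g) = hasse Δ f * g := by
  induction Δ using multiindex_induction with
  | zero => simp
  | step Δ h ih =>
    rw [hasse_add_single, ih, hasse_add_single, Derivation.leibniz, hg h, smul_zero, zero_add,
      smul_eq_mul, smul_mul_assoc, mul_comm]
    · simp
    · intro i hi
      refine hg i ?_
      simp only [Finsupp.mem_support_iff, Finsupp.coe_add, Pi.add_apply] at hi ⊢
      omega

end HasseDerivative

section Shift

variable {σ : Type*}

/-- The translate `P (X + β)` of a polynomial. -/
noncomputable def shift (β : σ → ℝ) : MvPolynomial σ ℝ →ₐ[ℝ] MvPolynomial σ ℝ :=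
  aeval fun h => X h + C (β h)

@[simp] lemma shift_X (β : σ → ℝ) (h : σ) : shift β (X h) = X h + C (β h) := by simp [shift]

lemma shift_neg_shift (β : σ → ℝ) (P : MvPolynomial σ ℝ) : shift (-β) (shift β P) = P := by
  have : (shift (-β)).comp (shift β) = AlgHom.id ℝ _ := by
    ext h
    simp [shift]
  exact DFunLike.congr_fun this P

lemma shift_ne_zero (β : σ → ℝ) {P : MvPolynomial σ ℝ} (hP : P ≠ 0) : shift β P ≠ 0 := by
  intro h
  apply hP
  rw [← shift_neg_shift β P, h, map_zero]

lemma pderiv_shift (β : σ → ℝ) (h : σ) (P : MvPolynomial σ ℝ) :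
    pderiv h (shift β P) = shift β (pderiv h P) := by
  classical
  induction P using MvPolynomial.induction_on with
  | C a => simp [shift]
  | add p q hp hq => simp [hp, hq]
  | mul_X p n hp =>
    simp only [map_mul, Derivation.leibniz, smul_eq_mul, map_add, hp, shift_X, pderiv_X, pderiv_C,
      Pi.single_apply, add_zero]
    split_ifs <;> simp

lemma hasse_shift [Fintype σ] (β : σ → ℝ) (Δ : σ →₀ ℕ) (P : MvPolynomial σ ℝ) :
    hasse Δ (shift β P) = shift β (hasse Δ P) := by
  induction Δ using multiindex_induction with
  | zero => simp
  | step Δ h ih => rw [hasse_add_single, hasse_add_single, ih, pderiv_shift, map_smul]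

lemma coeff_zero_shift (β : σ → ℝ) (P : MvPolynomial σ ℝ) : coeff 0 (shift β P) = eval β P := by
  have : (constantCoeff (R := ℝ) (σ := σ)).comp (shift β).toRingHom = eval β := by
    ext h
    · simp [shift]
    · simp
  exact DFunLike.congr_fun this P

/-- Taylor coefficients are values of Hasse derivatives. -/
lemma coeff_shift [Fintype σ] (β : σ → ℝ) (Δ : σ →₀ ℕ) (P : MvPolynomial σ ℝ) :
    coeff Δ (shift β P) = eval β (hasse Δ P) := by
  rw [← coeff_zero_shift, ← hasse_shift, coeff_hasse]
  simp [multichoose]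

lemma eval_shift (β x : σ → ℝ) (P : MvPolynomial σ ℝ) : eval x (shift β P) = eval (x + β) P := by
  have : (eval x).comp (shift β).toRingHom = eval (x + β) := by
    ext h <;> simp [shift]
  exact DFunLike.congr_fun this P

end Shift

section Length

variable {σ : Type*}

/-- The sum of the absolute values of the coefficients. -/
noncomputable def len (P : MvPolynomial σ ℝ) : ℝ := ∑ e ∈ P.support, |coeff e P|

lemma len_eq_sum {P : MvPolynomial σ ℝ} {s : Finset (σ →₀ ℕ)} (h : P.support ⊆ s) :
    len P = ∑ e ∈ s, |coeff e P| :=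
  Finset.sum_subset h fun e _ he => by simpa using he

lemma sum_abs_coeff_le_len (P : MvPolynomial σ ℝ) (s : Finset (σ →₀ ℕ)) :
    ∑ e ∈ s, |coeff e P| ≤ len P := by
  classical
  rw [len_eq_sum (Finset.subset_union_left (s₂ := s))]
  exact Finset.sum_le_sum_of_subset_of_nonneg Finset.subset_union_right fun _ _ _ => abs_nonneg _

lemma abs_coeff_le_len (P : MvPolynomial σ ℝ) (e : σ →₀ ℕ) : |coeff e P| ≤ len P := by
  simpa using sum_abs_coeff_le_len P {e}

lemma len_nonneg (P : MvPolynomial σ ℝ) : 0 ≤ len P := Finset.sum_nonneg fun _ _ => abs_nonneg _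

lemma len_pos {P : MvPolynomial σ ℝ} (hP : P ≠ 0) : 0 < len P := by
  obtain ⟨e, he⟩ := ne_zero_iff.mp hP
  exact (abs_pos.mpr he).trans_le (abs_coeff_le_len P e)

@[simp] lemma len_zero : len (0 : MvPolynomial σ ℝ) = 0 := by simp [len]

@[simp] lemma len_monomial (e : σ →₀ ℕ) (c : ℝ) : len (monomial e c) = |c| := by
  classical
  rw [len_eq_sum (support_monomial_subset), Finset.sum_singleton, coeff_monomial, if_pos rfl]

@[simp] lemma len_C (c : ℝ) : len (C c : MvPolynomial σ ℝ) = |c| := len_monomial 0 c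

@[simp] lemma len_one : len (1 : MvPolynomial σ ℝ) = 1 := by
  rw [← C_1, len_C, abs_one]

@[simp] lemma len_X (h : σ) : len (X h : MvPolynomial σ ℝ) = 1 := by
  rw [X, len_monomial, abs_one]

lemma len_add_le (P Q : MvPolynomial σ ℝ) : len (P + Q) ≤ len P + len Q := by
  classical
  rw [len_eq_sum (support_add (p := P) (q := Q)), len_eq_sum (P := P) Finset.subset_union_left,
    len_eq_sum (P := Q) (Finset.subset_union_right (s₁ := P.support)), ← Finset.sum_add_distrib]
  exact Finset.sum_le_sum fun e _ => by rw [coeff_add]; exact abs_add_le _ _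

lemma len_sum_le {ι : Type*} (s : Finset ι) (f : ι → MvPolynomial σ ℝ) :
    len (∑ i ∈ s, f i) ≤ ∑ i ∈ s, len (f i) :=
  Finset.le_sum_of_subadditive _ len_zero.le len_add_le _ _

lemma len_monomial_mul (e : σ →₀ ℕ) (c : ℝ) (P : MvPolynomial σ ℝ) :
    len (monomial e c * P) ≤ |c| * len P := by
  conv_lhs => rw [P.as_sum, Finset.mul_sum]
  refine (len_sum_le _ _).trans ?_
  rw [len, Finset.mul_sum]
  exact Finset.sum_le_sum fun a _ => by rw [monomial_mul, len_monomial, abs_mul]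

lemma len_mul_le (P Q : MvPolynomial σ ℝ) : len (P * Q) ≤ len P * len Q := by
  conv_lhs => rw [P.as_sum, Finset.sum_mul]
  refine (len_sum_le _ _).trans ?_
  rw [len, Finset.sum_mul]
  exact Finset.sum_le_sum fun e _ => len_monomial_mul _ _ _

lemma len_prod_le {ι : Type*} (s : Finset ι) (f : ι → MvPolynomial σ ℝ) :
    len (∏ i ∈ s, f i) ≤ ∏ i ∈ s, len (f i) := by
  classical
  induction s using Finset.induction_on with
  | empty => simp
  | insert a s ha ih =>
    rw [Finset.prod_insert ha, Finset.prod_insert ha]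
    exact (len_mul_le _ _).trans (mul_le_mul_of_nonneg_left ih (len_nonneg _))

lemma len_pow_le (P : MvPolynomial σ ℝ) (n : ℕ) : len (P ^ n) ≤ len P ^ n := by
  simpa using len_prod_le (Finset.range n) fun _ => P

lemma len_det_le {k : ℕ} (M : Matrix (Fin k) (Fin k) (MvPolynomial σ ℝ)) {c : ℝ}
    (hM : ∀ i j, len (M i j) ≤ c) : len M.det ≤ (k * c) ^ k := by
  rcases Nat.eq_zero_or_pos k with rfl | hk
  · simp
  have hc : 0 ≤ c := (len_nonneg _).trans (hM ⟨0, hk⟩ ⟨0, hk⟩)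
  rw [Matrix.det_apply]
  have hterm : ∀ τ : Equiv.Perm (Fin k),
      len (Equiv.Perm.sign τ • ∏ i, M (τ i) i) ≤ c ^ k := by
    intro τ
    have h1 : len (∏ i, M (τ i) i) ≤ c ^ k := by
      refine (len_prod_le _ _).trans ?_
      calc ∏ i, len (M (τ i) i) ≤ ∏ _i : Fin k, c :=
            Finset.prod_le_prod (fun _ _ => len_nonneg _) fun i _ => hM _ _
        _ = c ^ k := by simp
    rcases Int.units_eq_one_or (Equiv.Perm.sign τ) with h | h
    · rw [h, one_smul]; exact h1
    · rw [h]
      have : len (-(∏ i, M (τ i) i)) = len (∏ i, M (τ i) i) := by simp [len]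
      simpa [this] using h1
  refine (len_sum_le _ _).trans ((Finset.sum_le_sum fun τ _ => hterm τ).trans ?_)
  rw [Finset.sum_const, Finset.card_univ, Fintype.card_perm, Fintype.card_fin, nsmul_eq_mul, mul_pow]
  gcongr
  exact_mod_cast Nat.factorial_le_pow k

lemma len_hasse_le [Fintype σ] (Δ : σ →₀ ℕ) {P : MvPolynomial σ ℝ} {N : ℕ}
    (hN : ∀ e ∈ P.support, ∑ h, e h ≤ N) : len (hasse Δ P) ≤ 2 ^ N * len P := by
  classical
  have h1 : len (hasse Δ P) ≤
      ∑ I ∈ (hasse Δ P).support, 2 ^ N * |coeff (I + Δ) P| := by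
    refine Finset.sum_le_sum fun I hI => ?_
    rw [mem_support_iff, coeff_hasse] at hI
    rw [coeff_hasse, abs_mul, Nat.abs_cast]
    refine mul_le_mul_of_nonneg_right ?_ (abs_nonneg _)
    have h2 := (multichoose_le I Δ).trans
      (Nat.pow_le_pow_right two_pos (hN _ (mem_support_iff.mpr (right_ne_zero_of_mul hI))))
    exact_mod_cast h2
  refine h1.trans ?_
  rw [← Finset.mul_sum]
  refine mul_le_mul_of_nonneg_left ?_ (by positivity)
  rw [← Finset.sum_image (f := fun e => |coeff e P|) (g := fun I => I + Δ)
    (fun _ _ _ _ h => add_right_cancel h)]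
  exact sum_abs_coeff_le_len _ _

lemma len_shift_le [Fintype σ] (β : σ → ℝ) {P : MvPolynomial σ ℝ} {N : ℕ} {B : ℝ} (hB : 1 ≤ B)
    (hβ : ∀ h, 1 + |β h| ≤ B) (hN : ∀ e ∈ P.support, ∑ h, e h ≤ N) :
    len (shift β P) ≤ B ^ N * len P := by
  conv_lhs => rw [P.as_sum, map_sum]
  refine (len_sum_le _ _).trans ?_
  rw [len, Finset.mul_sum]
  refine Finset.sum_le_sum fun e he => ?_
  rw [monomial_eq, map_mul, Finsupp.prod_fintype _ _ (fun _ => pow_zero _), map_prod]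
  refine (len_mul_le _ _).trans ?_
  have h1 : len (shift β (C (coeff e P))) = |coeff e P| := by simp [shift]
  rw [h1, mul_comm]
  refine mul_le_mul_of_nonneg_right ?_ (abs_nonneg _)
  refine (len_prod_le _ _).trans ?_
  calc ∏ h, len (shift β (X h ^ e h)) ≤ ∏ h, B ^ e h := by
        refine Finset.prod_le_prod (fun _ _ => len_nonneg _) fun h _ => ?_
        rw [map_pow, shift_X]
        refine (len_pow_le _ _).trans (pow_le_pow_left₀ (len_nonneg _) ?_ _)
        refine (len_add_le _ _).trans ?_
        simpa using hβ h
    _ = B ^ ∑ h, e h := by rw [Finset.prod_pow_eq_pow_sum]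
    _ ≤ B ^ N := pow_le_pow_right₀ hB (hN e he)

end Length

section Integrality

variable {σ : Type*}

/-- The subring of real polynomials with integer coefficients. -/
noncomputable def intPoly (σ : Type*) : Subring (MvPolynomial σ ℝ) :=
  (map (Int.castRingHom ℝ)).range

lemma mem_intPoly_iff {P : MvPolynomial σ ℝ} :
    P ∈ intPoly σ ↔ ∀ e, ∃ z : ℤ, coeff e P = z := by
  constructor
  · rintro ⟨Q, rfl⟩ e
    exact ⟨coeff e Q, by simp [coeff_map]⟩
  · intro h
    rw [P.as_sum]
    refine Subring.sum_mem _ fun e _ => ?_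
    obtain ⟨z, hz⟩ := h e
    exact ⟨monomial e z, by simp [map_monomial, hz]⟩

lemma hasse_mem_intPoly [Fintype σ] {P : MvPolynomial σ ℝ} (hP : P ∈ intPoly σ) (Δ : σ →₀ ℕ) :
    hasse Δ P ∈ intPoly σ := by
  rw [mem_intPoly_iff] at hP ⊢
  intro e
  obtain ⟨z, hz⟩ := hP (e + Δ)
  exact ⟨multichoose e Δ * z, by rw [coeff_hasse, hz]; push_cast; rfl⟩

end Integrality

section Supported

variable {σ : Type*}

lemma mem_supported_iff_coeff {f : MvPolynomial σ ℝ} {T : Set σ} :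
    f ∈ supported ℝ T ↔ ∀ e, coeff e f ≠ 0 → ∀ h, e h ≠ 0 → h ∈ T := by
  rw [mem_supported]
  constructor
  · intro hf e he h hh
    exact hf ((mem_vars_iff_mem_support h).mpr
      ⟨e, mem_support_iff.mpr he, Finsupp.mem_support_iff.mpr hh⟩)
  · intro hf h hh
    obtain ⟨e, he, hhe⟩ := (mem_vars_iff_mem_support h).mp hh
    exact hf e (mem_support_iff.mp he) h (Finsupp.mem_support_iff.mp hhe)

lemma hasse_mem_supported [Fintype σ] {f : MvPolynomial σ ℝ} {T : Set σ} (hf : f ∈ supported ℝ T)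
    (Δ : σ →₀ ℕ) : hasse Δ f ∈ supported ℝ T := by
  rw [mem_supported_iff_coeff] at hf ⊢
  intro e he h hh
  rw [coeff_hasse] at he
  exact hf _ (right_ne_zero_of_mul he) h (by simp [hh])

lemma hasse_eq_zero_of_supported [Fintype σ] {f : MvPolynomial σ ℝ} {T : Set σ}
    (hf : f ∈ supported ℝ T) {Δ : σ →₀ ℕ} {h : σ} (hΔ : Δ h ≠ 0) (hT : h ∉ T) :
    hasse Δ f = 0 := by
  rw [mem_supported_iff_coeff] at hf
  ext e
  rw [coeff_hasse, coeff_zero]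
  by_contra hne
  exact hT (hf _ (right_ne_zero_of_mul hne) h (by simp [hΔ]))

lemma pderiv_eq_zero_of_supported {f : MvPolynomial σ ℝ} {T : Set σ}
    (hf : f ∈ supported ℝ T) {h : σ} (hT : h ∉ T) : pderiv h f = 0 :=
  pderiv_eq_zero_of_notMem_vars fun hh => hT (mem_supported.mp hf hh)

lemma shift_mem_supported (β : σ → ℝ) {f : MvPolynomial σ ℝ} {T : Set σ}
    (hf : f ∈ supported ℝ T) : shift β f ∈ supported ℝ T := by
  have h : supported ℝ T ≤ (supported ℝ T).comap (shift β) := by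
    refine Algebra.adjoin_le ?_
    rintro _ ⟨h, hh, rfl⟩
    change shift β (X h) ∈ supported ℝ T
    rw [shift_X]
    exact add_mem (X_mem_supported.mpr hh) (Subalgebra.algebraMap_mem _ _)
  exact h hf

/-- Coefficients of a product of two polynomials in disjoint sets of variables. -/
lemma coeff_add_mul_of_disjoint {T T' : Set σ} (hd : Disjoint T T') {f g : MvPolynomial σ ℝ}
    (hf : f ∈ supported ℝ T) (hg : g ∈ supported ℝ T') {I J : σ →₀ ℕ}
    (hI : ∀ h, I h ≠ 0 → h ∈ T) (hJ : ∀ h, J h ≠ 0 → h ∈ T') :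
    coeff (I + J) (f * g) = coeff I f * coeff J g := by
  classical
  rw [coeff_mul]
  refine Finset.sum_eq_single (I, J) ?_ (fun h => absurd (by simp) h)
  rintro ⟨a, b⟩ hab hne
  rw [Finset.HasAntidiagonal.mem_antidiagonal] at hab
  by_contra hmul
  have ha := mem_supported_iff_coeff.mp hf a (left_ne_zero_of_mul hmul)
  have hb := mem_supported_iff_coeff.mp hg b (right_ne_zero_of_mul hmul)
  have key : ∀ h, a h = I h ∧ b h = J h := by
    intro h
    have hsum : a h + b h = I h + J h := DFunLike.congr_fun hab h
    by_cases hT : h ∈ T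
    · have hT' : h ∉ T' := fun h' => Set.disjoint_left.mp hd hT h'
      have h1 : b h = 0 := by_contra fun h1 => hT' (hb h h1)
      have h2 : J h = 0 := by_contra fun h1 => hT' (hJ h h1)
      omega
    · have h1 : a h = 0 := by_contra fun h1 => hT (ha h h1)
      have h2 : I h = 0 := by_contra fun h1 => hT (hI h h1)
      omega
  exact hne (Prod.ext (Finsupp.ext fun h => (key h).1) (Finsupp.ext fun h => (key h).2))

end Supported

section Wronskian

variable {σ : Type*}

lemma degreeOf_pderiv_lt {g : MvPolynomial σ ℝ} {h : σ} (hg : pderiv h g ≠ 0) :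
    degreeOf h (pderiv h g) < degreeOf h g := by
  have hpos : 0 < degreeOf h g := by
    by_contra! h0
    apply hg
    apply pderiv_eq_zero_of_notMem_vars
    rw [mem_vars_iff_mem_support]
    rintro ⟨d, hd, hhd⟩
    exact (Finsupp.mem_support_iff.mp hhd) (Nat.le_zero.mp (degreeOf_le_iff.mp h0 d hd))
  rw [degreeOf_lt_iff hpos]
  intro m hm
  rw [mem_support_iff, coeff_pderiv] at hm
  have := monomial_le_degreeOf h (mem_support_iff.mpr (left_ne_zero_of_mul hm))
  simp only [Finsupp.coe_add, Pi.add_apply, Finsupp.single_eq_same] at this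
  omega

lemma pderiv_eq_zero_of_dvd {g : MvPolynomial σ ℝ} {h : σ} (hg : g ∣ pderiv h g) :
    pderiv h g = 0 := by
  by_contra hne
  obtain ⟨f, hf⟩ := hg
  have hlt := degreeOf_pderiv_lt hne
  have hf0 : f ≠ 0 := by rintro rfl; simp [hf] at hne
  have hg0 : g ≠ 0 := by rintro rfl; simp at hne
  have : degreeOf h (pderiv h g) = degreeOf h g + degreeOf h f := by
    conv_lhs => rw [hf]
    exact degreeOf_mul_eq hg0 hf0
  omega

lemma eq_C_of_pderiv_eq_zero {g : MvPolynomial σ ℝ} (hg : ∀ h, pderiv h g = 0) :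
    g = C (coeff 0 g) := by
  classical
  ext e
  rw [coeff_C]
  split_ifs with h
  · rw [h]
  · obtain ⟨i, hi⟩ : ∃ i, e i ≠ 0 := by
      by_contra! hcon
      exact h (Finsupp.ext fun i => (hcon i).symm)
    have h1 := congrArg (coeff (e - Finsupp.single i 1)) (hg i)
    rw [coeff_pderiv, coeff_zero, tsub_add_cancel_of_le] at h1
    · exact (mul_eq_zero.mp h1).resolve_right (by positivity)
    · rw [Finsupp.single_le_iff]; omega

/-- Two polynomials with the same logarithmic derivatives are proportional. -/
lemma exists_eq_C_mul_of_logDeriv_eq {a w : MvPolynomial σ ℝ} (hw : w ≠ 0)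
    (h : ∀ i, w * pderiv i a = a * pderiv i w) : ∃ c : ℝ, a = C c * w := by
  obtain ⟨w', a', c, hrel, rfl, rfl⟩ := UniqueFactorizationMonoid.exists_reduced_factors w hw a
  have hc : c ≠ 0 := left_ne_zero_of_mul hw
  have hred : ∀ i, w' * pderiv i a' = a' * pderiv i w' := by
    intro i
    have h1 := h i
    simp only [Derivation.leibniz, smul_eq_mul] at h1
    refine mul_left_cancel₀ (mul_ne_zero hc hc) ?_
    linear_combination h1
  have hw' : ∀ i, pderiv i w' = 0 := fun i =>
    pderiv_eq_zero_of_dvd (hrel.dvd_of_dvd_mul_left (Dvd.intro _ (hred i)))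
  have ha' : ∀ i, pderiv i a' = 0 := fun i =>
    pderiv_eq_zero_of_dvd (hrel.symm.dvd_of_dvd_mul_left (Dvd.intro _ (hred i).symm))
  rw [eq_C_of_pderiv_eq_zero hw'] at hw ⊢
  rw [eq_C_of_pderiv_eq_zero ha']
  have hw0 : coeff 0 w' ≠ 0 := by
    intro h0
    rw [h0, C_0, mul_zero] at hw
    exact hw rfl
  refine ⟨coeff 0 a' / coeff 0 w', ?_⟩
  rw [mul_left_comm, ← C_mul, div_mul_cancel₀ _ hw0]

/-- Linearly independent polynomials have a nonvanishing generalised Wronskian. -/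
theorem exists_det_hasse_ne_zero [Fintype σ] {k : ℕ} (φ : Fin k → MvPolynomial σ ℝ)
    (hφ : LinearIndependent ℝ φ) :
    ∃ Δ : Fin k → σ →₀ ℕ, (∀ i, (Δ i).degree + i < k) ∧
      (Matrix.of fun i j => hasse (Δ i) (φ j)).det ≠ 0 := by
  induction k with
  | zero => exact ⟨fun i => i.elim0, fun i => i.elim0, by simp⟩
  | succ k ih =>
    obtain ⟨Δ, hΔ, hdet⟩ := ih (fun j => φ j.succ) (hφ.comp _ (Fin.succ_injective k))
    by_contra! hcon
    set w := (Matrix.of fun i j => hasse (Δ i) (φ (Fin.succ j))).det with hw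
    let a : Fin (k + 1) → MvPolynomial σ ℝ := fun j =>
      (-1) ^ (j : ℕ) * (Matrix.of fun (i j' : Fin k) => hasse (Δ i) (φ (j.succAbove j'))).det
    have ha0 : a 0 = w := by simp [a, hw]
    have hrel : ∀ Θ : σ →₀ ℕ, Θ.degree ≤ k → ∑ j, a j * hasse Θ (φ j) = 0 := by
      intro Θ hΘ
      have h1 := hcon (Fin.cons Θ Δ) (by
        intro i
        refine Fin.cases ?_ (fun i => ?_) i
        · simpa using Nat.lt_succ_of_le hΘ
        · have := hΔ i
          simp only [Fin.cons_succ, Fin.val_succ]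
          omega)
      rw [Matrix.det_succ_row_zero] at h1
      rw [← h1]
      refine Finset.sum_congr rfl fun j _ => ?_
      simp only [a, Matrix.of_apply, Fin.cons_zero]
      rw [mul_right_comm]
      rfl
    have hprop : ∀ j, ∃ c : ℝ, a j = C c * w := by
      intro j
      refine exists_eq_C_mul_of_logDeriv_eq hdet fun h => ?_
      let b : Fin (k + 1) → MvPolynomial σ ℝ := fun j =>
        w * pderiv h (a j) - a j * pderiv h w
      have hb0 : b 0 = 0 := by simp only [b, ha0]; ring
      have hb : (fun j : Fin k => b j.succ) = 0 := by
        refine Matrix.eq_zero_of_mulVec_eq_zero hdet ?_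
        ext1 i
        have h1 : ∑ j, a j * hasse (Δ i) (φ j) = 0 := hrel _ (by have := hΔ i; omega)
        have h2 : ∑ j, a j * hasse (Δ i + Finsupp.single h 1) (φ j) = 0 := by
          refine hrel _ ?_
          have := hΔ i
          rw [map_add, Finsupp.degree_single]
          omega
        have h3 : ∑ j, pderiv h (a j) * hasse (Δ i) (φ j) = 0 := by
          have h4 := congrArg (pderiv h) h1
          simp only [map_sum, Derivation.leibniz, smul_eq_mul, map_zero, pderiv_hasse,
            mul_smul_comm, Finset.sum_add_distrib, ← Finset.smul_sum, h2, smul_zero, zero_add] at h4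
          rw [← h4]
          exact Finset.sum_congr rfl fun _ _ => mul_comm _ _
        have h5 : ∑ j, b j * hasse (Δ i) (φ j) = 0 := by
          calc ∑ j, b j * hasse (Δ i) (φ j)
              = w * ∑ j, pderiv h (a j) * hasse (Δ i) (φ j) -
                pderiv h w * ∑ j, a j * hasse (Δ i) (φ j) := by
                rw [Finset.mul_sum, Finset.mul_sum, ← Finset.sum_sub_distrib]
                refine Finset.sum_congr rfl fun j _ => ?_
                simp only [b]
                ring
            _ = 0 := by rw [h3, h1]; ring
        rw [Fin.sum_univ_succ, hb0, zero_mul, zero_add] at h5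
        rw [Pi.zero_apply, ← h5]
        simp only [Matrix.mulVec, dotProduct, Matrix.of_apply]
        exact Finset.sum_congr rfl fun _ _ => mul_comm _ _
      have hbj : b j = 0 := by
        refine Fin.cases hb0 (fun j => ?_) j
        exact congrFun hb j
      exact sub_eq_zero.mp hbj
    choose c hc using hprop
    have h0 : ∑ j, c j • φ j = 0 := by
      have h1 := hrel 0 (by simp)
      simp only [hasse_zero] at h1
      refine (mul_eq_zero_iff_left hdet).mp ?_
      rw [← h1, Finset.mul_sum]
      refine Finset.sum_congr rfl fun j _ => ?_
      rw [hc j, smul_eq_C_mul]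
      ring
    have hc0 := Fintype.linearIndependent_iff.mp hφ c h0 0
    have := hc 0
    rw [hc0, C_0, zero_mul, ha0] at this
    exact hdet this

end Wronskian

section Decomposition

variable {K A : Type*} [Field K] [CommRing A] [Algebra K A]

/-- A decomposition `x = ∑ φ j * ψ j` with dependent `φ` can be shortened. -/
lemma exists_shorter_decomposition (U V : Submodule K A) {n : ℕ}
    {φ ψ : Fin n → A} (hφ : ∀ j, φ j ∈ U) (hψ : ∀ j, ψ j ∈ V) (hdep : ¬ LinearIndependent K φ) :
    ∃ m < n, ∃ φ' ψ' : Fin m → A, (∀ j, φ' j ∈ U) ∧ (∀ j, ψ' j ∈ V) ∧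
      ∑ j, φ' j * ψ' j = ∑ j, φ j * ψ j := by
  rw [Fintype.linearIndependent_iff] at hdep
  push Not at hdep
  obtain ⟨g, hg, i, hi⟩ := hdep
  obtain _ | n := n
  · exact i.elim0
  refine ⟨n, n.lt_succ_self, fun j => φ (i.succAbove j),
    fun j => ψ (i.succAbove j) - (g (i.succAbove j) / g i) • ψ i, fun j => hφ _,
    fun j => sub_mem (hψ _) (V.smul_mem _ (hψ i)), ?_⟩
  rw [Fin.sum_univ_succAbove _ i] at hg ⊢
  have hφi : φ i = -∑ j, (g (i.succAbove j) / g i) • φ (i.succAbove j) := by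
    have h1 : φ i = (g i)⁻¹ • (g i • φ i) := by rw [smul_smul, inv_mul_cancel₀ hi, one_smul]
    rw [h1, eq_neg_of_add_eq_zero_left hg, smul_neg, Finset.smul_sum]
    simp only [smul_smul, div_eq_inv_mul]
  rw [hφi, neg_mul, Finset.sum_mul, neg_add_eq_sub, ← Finset.sum_sub_distrib]
  refine Finset.sum_congr rfl fun j _ => ?_
  rw [mul_sub, mul_smul_comm, smul_mul_assoc]

lemma exists_linearIndependent_decomposition (U V : Submodule K A) {n : ℕ}
    {φ ψ : Fin n → A} (hφ : ∀ j, φ j ∈ U) (hψ : ∀ j, ψ j ∈ V) :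
    ∃ k ≤ n, ∃ φ' ψ' : Fin k → A, (∀ j, φ' j ∈ U) ∧ (∀ j, ψ' j ∈ V) ∧
      LinearIndependent K φ' ∧ LinearIndependent K ψ' ∧
      ∑ j, φ' j * ψ' j = ∑ j, φ j * ψ j := by
  induction n using Nat.strong_induction_on with
  | _ n ih =>
    by_cases h1 : LinearIndependent K φ
    · by_cases h2 : LinearIndependent K ψ
      · exact ⟨n, le_rfl, φ, ψ, hφ, hψ, h1, h2, rfl⟩
      · obtain ⟨m, hm, ψ', φ', hψ', hφ', heq⟩ := exists_shorter_decomposition V U hψ hφ h2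
        obtain ⟨k, hk, a, b, ha, hb, la, lb, hab⟩ := ih m hm hφ' hψ'
        refine ⟨k, hk.trans hm.le, a, b, ha, hb, la, lb, hab.trans ?_⟩
        simpa only [mul_comm] using heq
    · obtain ⟨m, hm, φ', ψ', hφ', hψ', heq⟩ := exists_shorter_decomposition U V hφ hψ h1
      obtain ⟨k, hk, a, b, ha, hb, la, lb, hab⟩ := ih m hm hφ' hψ'
      exact ⟨k, hk.trans hm.le, a, b, ha, hb, la, lb, hab.trans heq⟩

lemma sum_monomial_erase_mem_supported {σ : Type*} {T : Set σ} {s : σ} {P : MvPolynomial σ ℝ}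
    (hP : P ∈ supported ℝ (insert s T)) (l : ℕ) :
    ∑ e ∈ P.support with e s = l, monomial (e.erase s) (coeff e P) ∈ supported ℝ T := by
  classical
  refine sum_mem fun e _ => ?_
  rw [mem_supported_iff_coeff]
  intro e' he' h hh
  rw [coeff_monomial] at he'
  split_ifs at he' with heq
  · subst heq
    have hs : h ≠ s := by rintro rfl; simp at hh
    rw [Finsupp.erase_ne hs] at hh
    exact (mem_supported_iff_coeff.mp hP e he' h hh).resolve_left hs
  · exact absurd rfl he'

/-- Separation of one variable from the others. -/
lemma exists_separation {σ : Type*} {T : Set σ} {s : σ} {P : MvPolynomial σ ℝ} {d : ℕ}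
    (hP : P ∈ supported ℝ (insert s T)) (hd : ∀ e ∈ P.support, e s ≤ d) :
    ∃ k ≤ d + 1, ∃ φ ψ : Fin k → MvPolynomial σ ℝ, (∀ j, φ j ∈ supported ℝ T) ∧
      (∀ j, ψ j ∈ supported ℝ {s}) ∧ LinearIndependent ℝ φ ∧ LinearIndependent ℝ ψ ∧
      P = ∑ j, φ j * ψ j := by
  classical
  let φ : Fin (d + 1) → MvPolynomial σ ℝ := fun l =>
    ∑ e ∈ P.support with e s = (l : ℕ), monomial (e.erase s) (coeff e P)
  let ψ : Fin (d + 1) → MvPolynomial σ ℝ := fun l => X s ^ (l : ℕ)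
  have hφ : ∀ l, φ l ∈ supported ℝ T := fun l => sum_monomial_erase_mem_supported hP l
  have hψ : ∀ l, ψ l ∈ supported ℝ {s} := fun l =>
    Subalgebra.pow_mem _ (X_mem_supported.mpr (Set.mem_singleton s)) _
  obtain ⟨k, hk, a, b, ha, hb, la, lb, hab⟩ := exists_linearIndependent_decomposition
    (Subalgebra.toSubmodule (supported ℝ T)) (Subalgebra.toSubmodule (supported ℝ {s}))
    (fun j => (Subalgebra.mem_toSubmodule _).mpr (hφ j))
    (fun j => (Subalgebra.mem_toSubmodule _).mpr (hψ j))
  refine ⟨k, hk, a, b, fun j => (Subalgebra.mem_toSubmodule _).mp (ha j),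
    fun j => (Subalgebra.mem_toSubmodule _).mp (hb j), la, lb, ?_⟩
  rw [hab]
  have hterm : ∀ l : Fin (d + 1), φ l * ψ l =
      ∑ e ∈ P.support with e s = (l : ℕ), monomial e (coeff e P) := by
    intro l
    simp only [φ, ψ, Finset.sum_mul]
    refine Finset.sum_congr rfl fun e he => ?_
    rw [X_pow_eq_monomial, monomial_mul, mul_one, ← (Finset.mem_filter.mp he).2,
      Finsupp.erase_add_single]
  rw [Finset.sum_congr rfl fun l _ => hterm l, Finset.sum_fin_eq_sum_range]
  conv_lhs => rw [P.as_sum]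
  rw [← Finset.sum_fiberwise_of_maps_to (s := P.support) (t := Finset.range (d + 1))
    (g := fun e => e s) (fun e he => Finset.mem_range.mpr (Nat.lt_succ_of_le (hd e he)))]
  refine Finset.sum_congr rfl fun l hl => ?_
  rw [dif_pos (Finset.mem_range.mp hl)]

end Decomposition

section WeightedOrder

variable {σ : Type*} [Fintype σ]

/-- The weighted degree `∑ h, e h / r h` of a multi-index. -/
noncomputable def wt (r : σ → ℕ) (e : σ →₀ ℕ) : ℝ := ∑ h, (e h : ℝ) / r h

lemma wt_nonneg (r : σ → ℕ) (e : σ →₀ ℕ) : 0 ≤ wt r e :=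
  Finset.sum_nonneg fun _ _ => by positivity

lemma wt_add (r : σ → ℕ) (e f : σ →₀ ℕ) : wt r (e + f) = wt r e + wt r f := by
  simp [wt, add_div, Finset.sum_add_distrib]

@[simp] lemma wt_zero (r : σ → ℕ) : wt r 0 = 0 := by simp [wt]

lemma wt_mul {k : ℕ} (hk : 0 < k) (r : σ → ℕ) (e : σ →₀ ℕ) :
    wt r e = k * wt (fun h => k * r h) e := by
  rw [wt, wt, Finset.mul_sum]
  refine Finset.sum_congr rfl fun h _ => ?_
  have : (k : ℝ) ≠ 0 := by positivity
  push_cast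
  rw [mul_div_assoc', mul_div_mul_left _ _ this]

/-- Every monomial of `f` has weighted degree at least `θ`. -/
def OrdGE (r : σ → ℕ) (θ : ℝ) (f : MvPolynomial σ ℝ) : Prop := ∀ e, coeff e f ≠ 0 → θ ≤ wt r e

lemma OrdGE.sum {r : σ → ℕ} {θ : ℝ} {ι : Type*} (s : Finset ι) (f : ι → MvPolynomial σ ℝ)
    (h : ∀ i ∈ s, OrdGE r θ (f i)) : OrdGE r θ (∑ i ∈ s, f i) := by
  intro e he
  rw [coeff_sum] at he
  obtain ⟨i, hi, hne⟩ := Finset.exists_ne_zero_of_sum_ne_zero he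
  exact h i hi e hne

lemma OrdGE.mul {r : σ → ℕ} {θ η : ℝ} {f g : MvPolynomial σ ℝ} (hf : OrdGE r θ f)
    (hg : OrdGE r η g) : OrdGE r (θ + η) (f * g) := by
  classical
  intro e he
  rw [coeff_mul] at he
  obtain ⟨⟨a, b⟩, hi, hne⟩ := Finset.exists_ne_zero_of_sum_ne_zero he
  rw [Finset.HasAntidiagonal.mem_antidiagonal] at hi
  rw [← hi, wt_add]
  exact add_le_add (hf a (left_ne_zero_of_mul hne)) (hg b (right_ne_zero_of_mul hne))

lemma OrdGE.prod {r : σ → ℕ} {ι : Type*} (s : Finset ι) (θ : ι → ℝ) (f : ι → MvPolynomial σ ℝ)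
    (h : ∀ i ∈ s, OrdGE r (θ i) (f i)) : OrdGE r (∑ i ∈ s, θ i) (∏ i ∈ s, f i) := by
  classical
  induction s using Finset.induction_on with
  | empty => intro e _; simpa using wt_nonneg r e
  | insert a s ha ih =>
    rw [Finset.sum_insert ha, Finset.prod_insert ha]
    exact (h a (Finset.mem_insert_self _ _)).mul
      (ih fun i hi => h i (Finset.mem_insert_of_mem hi))

lemma OrdGE.det {r : σ → ℕ} {k : ℕ} {M : Matrix (Fin k) (Fin k) (MvPolynomial σ ℝ)}
    {θ : Fin k → ℝ} (h : ∀ i j, OrdGE r (θ j) (M i j)) : OrdGE r (∑ j, θ j) M.det := by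
  rw [Matrix.det_apply]
  refine OrdGE.sum _ _ fun τ _ => ?_
  have h1 := OrdGE.prod Finset.univ θ (fun j => M (τ j) j) fun j _ => h (τ j) j
  rcases Int.units_eq_one_or (Equiv.Perm.sign τ) with hs | hs
  · rw [hs, one_smul]; exact h1
  · rw [hs]
    intro e he
    refine h1 e fun h0 => he ?_
    simp [h0]

lemma OrdGE.hasse {r : σ → ℕ} {θ : ℝ} {f : MvPolynomial σ ℝ} (hf : OrdGE r θ f) (Δ : σ →₀ ℕ) :
    OrdGE r (θ - wt r Δ) (hasse Δ f) := by
  intro e he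
  rw [coeff_hasse] at he
  have := hf _ (right_ne_zero_of_mul he)
  rw [wt_add] at this
  linarith

end WeightedOrder

section Admissible

variable {σ : Type*} [LinearOrder σ]

/-- The hypotheses of Roth's lemma with parameter `ω`, for a polynomial `P` in the variables of `S`
and the rational point `p / q`: here `H` is a common lower bound of the `r h * log (q h)`. -/
structure IsAdmissible (ω : ℝ) (S : Finset σ) (r : σ → ℕ) (H : ℝ) (p q : σ → ℤ)
    (P : MvPolynomial σ ℝ) : Prop where
  r_pos : ∀ h ∈ S, 0 < r h
  q_pos : ∀ h ∈ S, 0 < q h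
  coprime : ∀ h ∈ S, IsCoprime (p h) (q h)
  decay : ∀ i ∈ S, ∀ j ∈ S, i < j → (r j : ℝ) ≤ ω * r i
  r_le : ∀ h ∈ S, (r h : ℝ) ≤ ω * H
  le_log : ∀ h ∈ S, H ≤ r h * Real.log (q h)
  ne_zero : P ≠ 0
  supp : P ∈ supported ℝ (S : Set σ)
  deg_le : ∀ e ∈ P.support, ∀ h ∈ S, e h ≤ r h
  int : P ∈ intPoly σ
  log_len_le : Real.log (len P) ≤ ω * H

end Admissible

section OneVariable

variable {σ : Type*}

lemma coeff_single_aeval_X (s : σ) (f : Polynomial ℝ) (n : ℕ) :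
    coeff (Finsupp.single s n) (Polynomial.aeval (X s : MvPolynomial σ ℝ) f) = f.coeff n := by
  classical
  induction f using Polynomial.induction_on' with
  | add f g hf hg => rw [map_add, coeff_add, hf, hg, Polynomial.coeff_add]
  | monomial m a =>
    rw [Polynomial.aeval_monomial, algebraMap_eq, coeff_C_mul, coeff_X_pow,
      Polynomial.coeff_monomial]
    simp only [(Finsupp.single_injective s).eq_iff, mul_ite, mul_one, mul_zero]

lemma shift_aeval_X (β : σ → ℝ) (s : σ) (f : Polynomial ℝ) :
    shift β (Polynomial.aeval (X s : MvPolynomial σ ℝ) f) =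
      Polynomial.aeval (X s : MvPolynomial σ ℝ) (f.comp (Polynomial.X + Polynomial.C (β s))) := by
  rw [← Polynomial.aeval_algHom_apply, Polynomial.aeval_comp, shift_X]
  simp [algebraMap_eq]

lemma isPrimitive_linear {p q : ℤ} (hpq : IsCoprime p q) :
    (Polynomial.C q * Polynomial.X - Polynomial.C p).IsPrimitive := by
  intro c hc
  rw [Polynomial.C_dvd_iff_dvd_coeff] at hc
  have h0 := hc 0
  have h1 := hc 1
  simp only [Polynomial.coeff_sub, Polynomial.coeff_C_mul, Polynomial.coeff_X_zero, mul_zero,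
    Polynomial.coeff_C_zero, zero_sub, dvd_neg] at h0
  simp only [Polynomial.coeff_sub, Polynomial.coeff_C_mul, Polynomial.coeff_X_one, mul_one,
    Polynomial.coeff_C_succ, sub_zero] at h1
  exact hpq.isUnit_of_dvd' h0 h1

/-- If an integer polynomial vanishes to order `l` at `p / q`, then `q ^ l` divides its leading
coefficient. -/
lemma pow_dvd_leadingCoeff {p q : ℤ} (hq : q ≠ 0) (hpq : IsCoprime p q) {g : Polynomial ℤ} {l : ℕ}
    (h : (Polynomial.X - Polynomial.C ((p : ℝ) / q)) ^ l ∣ g.map (Int.castRingHom ℝ)) :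
    q ^ l ∣ g.leadingCoeff := by
  have hprim : ((Polynomial.C q * Polynomial.X - Polynomial.C p) ^ l).IsPrimitive := by
    induction l with
    | zero => simp
    | succ l ih =>
      rw [pow_succ]
      exact (ih ((pow_dvd_pow _ l.le_succ).trans h)).mul (isPrimitive_linear hpq)
  have hQ : (Polynomial.X - Polynomial.C ((p : ℚ) / q)) ^ l ∣ g.map (Int.castRingHom ℚ) := by
    rw [← Polynomial.map_dvd_map' (algebraMap ℚ ℝ), Polynomial.map_map]
    have : (algebraMap ℚ ℝ).comp (Int.castRingHom ℚ) = Int.castRingHom ℝ := RingHom.ext_int _ _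
    rw [this]
    simpa using h
  have hdvd : (Polynomial.C q * Polynomial.X - Polynomial.C p) ^ l ∣ g := by
    rw [Polynomial.IsPrimitive.Int.dvd_iff_map_cast_dvd_map_cast _ _ hprim]
    have hq' : (q : ℚ) ≠ 0 := by exact_mod_cast hq
    have hfac : ((Polynomial.C q * Polynomial.X - Polynomial.C p) ^ l).map (Int.castRingHom ℚ) =
        Polynomial.C ((q : ℚ) ^ l) * (Polynomial.X - Polynomial.C ((p : ℚ) / q)) ^ l := by
      rw [Polynomial.C_pow, ← mul_pow, mul_sub, ← Polynomial.C_mul, mul_div_cancel₀ _ hq']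
      simp
    rw [hfac]
    exact (Polynomial.C_mul_dvd (pow_ne_zero _ hq')).mpr hQ
  obtain ⟨u, hu⟩ := hdvd
  rw [hu, Polynomial.leadingCoeff_mul, Polynomial.leadingCoeff_pow]
  have hlc : (Polynomial.C q * Polynomial.X - Polynomial.C p).leadingCoeff = q := by
    rw [sub_eq_add_neg, ← Polynomial.C_neg, Polynomial.leadingCoeff_linear hq]
  rw [hlc]
  exact dvd_mul_right _ _

/-- Roth's lemma in one variable. -/
lemma exists_wt_le_of_isAdmissible_singleton [Fintype σ] [LinearOrder σ] {s : σ} {ε : ℝ}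
    (hε : 0 < ε) {r : σ → ℕ} {H : ℝ} {p q : σ → ℤ} {P : MvPolynomial σ ℝ}
    (h : IsAdmissible ε {s} r H p q P) :
    ∃ e, coeff e (shift (fun h => (p h : ℝ) / q h) P) ≠ 0 ∧ wt r e ≤ ε := by
  by_contra! hcon
  have hs : s ∈ ({s} : Finset σ) := Finset.mem_singleton_self s
  obtain ⟨f, rfl⟩ : ∃ f : Polynomial ℝ, Polynomial.aeval (X s : MvPolynomial σ ℝ) f = P := by
    have h1 := h.supp
    rw [Finset.coe_singleton, supported, Set.image_singleton,
      Algebra.adjoin_singleton_eq_range_aeval] at h1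
    exact h1
  obtain ⟨g, rfl⟩ : ∃ g : Polynomial ℤ, g.map (Int.castRingHom ℝ) = f := by
    rw [← Polynomial.mem_lifts, Polynomial.lifts_iff_coeff_lifts]
    intro n
    obtain ⟨z, hz⟩ := mem_intPoly_iff.mp h.int (Finsupp.single s n)
    exact ⟨z, by rw [← coeff_single_aeval_X s, hz]; rfl⟩
  have hg : g ≠ 0 := by
    rintro rfl
    exact h.ne_zero (by simp)
  have hr : (0 : ℝ) < r s := by exact_mod_cast h.r_pos s hs
  have hq := h.q_pos s hs
  have hH : 0 < H := pos_of_mul_pos_right (hr.trans_le (h.r_le s hs)) hε.le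
  set l := ⌊ε * r s⌋₊ + 1 with hl
  have hdvd : (Polynomial.X - Polynomial.C ((p s : ℝ) / q s)) ^ l ∣
      g.map (Int.castRingHom ℝ) := by
    rw [Polynomial.X_sub_C_pow_dvd_iff, Polynomial.X_pow_dvd_iff]
    intro n hn
    by_contra hne
    rw [← coeff_single_aeval_X s, ← shift_aeval_X (fun h => (p h : ℝ) / q h)] at hne
    have h1 := hcon _ hne
    have h2 : wt r (Finsupp.single s n) = n / r s := by
      rw [wt, Finset.sum_eq_single s]
      · simp
      · intro b _ hb
        simp [Finsupp.single_eq_of_ne hb]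
      · simp
    rw [h2, lt_div_iff₀ hr] at h1
    have h3 : (n : ℝ) ≤ ⌊ε * r s⌋₊ := by exact_mod_cast Nat.lt_succ_iff.mp hn
    linarith [Nat.floor_le (mul_nonneg hε.le hr.le)]
  have hlc := pow_dvd_leadingCoeff hq.ne' (h.coprime s hs) hdvd
  have hle : ((q s : ℝ)) ^ l ≤ len (Polynomial.aeval (X s : MvPolynomial σ ℝ)
      (g.map (Int.castRingHom ℝ))) := by
    have h1 : q s ^ l ≤ |g.leadingCoeff| :=
      Int.le_of_dvd (abs_pos.mpr (Polynomial.leadingCoeff_ne_zero.mpr hg)) ((dvd_abs _ _).mpr hlc)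
    have h2 := abs_coeff_le_len (Polynomial.aeval (X s : MvPolynomial σ ℝ)
      (g.map (Int.castRingHom ℝ))) (Finsupp.single s g.natDegree)
    rw [coeff_single_aeval_X, Polynomial.coeff_map] at h2
    refine le_trans ?_ h2
    have h3 : ((q s ^ l : ℤ) : ℝ) ≤ (|g.leadingCoeff| : ℤ) := by exact_mod_cast h1
    simpa using h3
  have hq' : (0 : ℝ) < q s := by exact_mod_cast hq
  have hlog : l * Real.log (q s) ≤ ε * H := by
    rw [← Real.log_pow]
    exact (Real.log_le_log (pow_pos hq' _) hle).trans h.log_len_le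
  have hlogpos : 0 < Real.log (q s) := pos_of_mul_pos_right (hH.trans_le (h.le_log s hs)) hr.le
  have h5 : l * Real.log (q s) ≤ (ε * r s) * Real.log (q s) := by
    rw [mul_assoc]
    exact hlog.trans (mul_le_mul_of_nonneg_left (h.le_log s hs) hε.le)
  have h6 := le_of_mul_le_mul_right h5 hlogpos
  have h7 := Nat.lt_floor_add_one (ε * r s)
  rw [hl] at h6
  push_cast at h6
  linarith

end OneVariable

section Determinant

variable {σ : Type*}

lemma degreeOf_det_le {k d : ℕ} {h : σ} {M : Matrix (Fin k) (Fin k) (MvPolynomial σ ℝ)}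
    (hM : ∀ i j, degreeOf h (M i j) ≤ d) : degreeOf h M.det ≤ k * d := by
  rw [Matrix.det_apply]
  refine (degreeOf_sum_le h _ _).trans (Finset.sup_le fun τ _ => ?_)
  have h1 : degreeOf h (∏ i, M (τ i) i) ≤ k * d := by
    refine (degreeOf_prod_le h _ _).trans ((Finset.sum_le_sum fun i _ => hM _ _).trans ?_)
    simp
  rcases Int.units_eq_one_or (Equiv.Perm.sign τ) with hs | hs
  · rwa [hs, one_smul]
  · rwa [hs, Units.neg_smul, one_smul, degreeOf_neg]

lemma degreeOf_hasse_le [Fintype σ] (Δ : σ →₀ ℕ) (h : σ) (P : MvPolynomial σ ℝ) :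
    degreeOf h (hasse Δ P) ≤ degreeOf h P := by
  rw [degreeOf_le_iff]
  intro e he
  rw [mem_support_iff, coeff_hasse] at he
  have h1 := degreeOf_le_iff.mp (le_refl (degreeOf h P)) (e + Δ)
    (mem_support_iff.mpr (right_ne_zero_of_mul he))
  rw [Finsupp.add_apply] at h1
  omega

lemma det_mem_supported {T : Set σ} {k : ℕ} {M : Matrix (Fin k) (Fin k) (MvPolynomial σ ℝ)}
    (hM : ∀ i j, M i j ∈ supported ℝ T) : M.det ∈ supported ℝ T := by
  rw [Matrix.det_apply]
  exact sum_mem fun τ _ => zsmul_mem (prod_mem fun i _ => hM _ _) _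

lemma det_mem_intPoly {k : ℕ} {M : Matrix (Fin k) (Fin k) (MvPolynomial σ ℝ)}
    (hM : ∀ i j, M i j ∈ intPoly σ) : M.det ∈ intPoly σ := by
  rw [Matrix.det_apply]
  exact sum_mem fun τ _ => zsmul_mem (prod_mem fun i _ => hM _ _) _

/-- A generalised Wronskian of `P` with respect to a splitting of the variables into `T` and `{s}`
is a product of a polynomial in the variables `T` and one in the variable `s`. -/
lemma exists_generalized_wronskian [Fintype σ] {T : Set σ} {s : σ} (hs : s ∉ T)
    {P : MvPolynomial σ ℝ} (hP0 : P ≠ 0) {d : ℕ}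
    (hP : P ∈ supported ℝ (insert s T)) (hd : ∀ e ∈ P.support, e s ≤ d) :
    ∃ k, 0 < k ∧ k ≤ d + 1 ∧ ∃ U ∈ supported ℝ T, ∃ V ∈ supported ℝ {s},
      ∃ Δ Θ : Fin k → σ →₀ ℕ, U ≠ 0 ∧ V ≠ 0 ∧
        (∀ i, (Δ i).degree + i < k) ∧ (∀ i, (Θ i).degree + i < k) ∧
        (∀ i h, Δ i h ≠ 0 → h ∈ T) ∧ (∀ i h, Θ i h ≠ 0 → h = s) ∧
        U * V = (Matrix.of fun i l => hasse (Δ i) (hasse (Θ l) P)).det := by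
  obtain ⟨k, hk, φ, ψ, hφ, hψ, hφi, hψi, hPe⟩ := exists_separation hP hd
  obtain ⟨Δ, hΔ, hU⟩ := exists_det_hasse_ne_zero φ hφi
  obtain ⟨Θ, hΘ, hV⟩ := exists_det_hasse_ne_zero ψ hψi
  have hΔT : ∀ i h, Δ i h ≠ 0 → h ∈ T := by
    intro i h hne
    by_contra hT
    exact hU (Matrix.det_eq_zero_of_row_eq_zero i fun j =>
      hasse_eq_zero_of_supported (hφ j) hne hT)
  have hΘs : ∀ i h, Θ i h ≠ 0 → h = s := by
    intro i h hne
    by_contra hT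
    exact hV (Matrix.det_eq_zero_of_row_eq_zero i fun j =>
      hasse_eq_zero_of_supported (hψ j) hne hT)
  have hUT : (Matrix.of fun i j => hasse (Δ i) (φ j)).det ∈ supported ℝ T :=
    det_mem_supported fun i j => hasse_mem_supported (hφ j) (Δ i)
  have hVs : (Matrix.of fun i j => hasse (Θ i) (ψ j)).det ∈ supported ℝ {s} :=
    det_mem_supported fun i j => hasse_mem_supported (hψ j) (Θ i)
  refine ⟨k, ?_, hk, _, hUT, _, hVs, Δ, Θ, hU, hV, hΔ, hΘ, hΔT, hΘs, ?_⟩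
  · rcases Nat.eq_zero_or_pos k with rfl | h
    · simp at hPe
      exact absurd hPe hP0
    · exact h
  · rw [← Matrix.det_transpose (Matrix.of fun i j => hasse (Θ i) (ψ j)), ← Matrix.det_mul]
    congr 1
    ext1 i l
    simp only [Matrix.mul_apply, Matrix.of_apply, Matrix.transpose_apply]
    rw [hPe, map_sum, map_sum]
    refine Finset.sum_congr rfl fun j _ => ?_
    have h1 : hasse (Θ l) (ψ j * φ j) = hasse (Θ l) (ψ j) * φ j := by
      refine hasse_mul_of_pderiv_eq_zero fun h hh => ?_
      refine pderiv_eq_zero_of_supported (hφ j) fun h2 => ?_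
      exact hs (hΘs l h (Finsupp.mem_support_iff.mp hh) ▸ h2)
    rw [mul_comm (φ j), h1, mul_comm _ (φ j), hasse_mul_of_pderiv_eq_zero]
    intro h hh
    refine pderiv_eq_zero_of_supported (hasse_mem_supported (hψ j) _) fun h2 => ?_
    rw [Set.mem_singleton_iff] at h2
    exact hs (h2 ▸ hΔT i h (Finsupp.mem_support_iff.mp hh))

/-- If `U * V` has integer coefficients and `U`, `V` involve disjoint sets of variables, then a
multiple of `U` is a slice of `U * V`. -/
lemma exists_C_mul_mem_intPoly {T T' : Set σ} (hd : Disjoint T T') {U V : MvPolynomial σ ℝ}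
    (hU : U ∈ supported ℝ T) (hV : V ∈ supported ℝ T') (hV0 : V ≠ 0) (hi : U * V ∈ intPoly σ) :
    ∃ c : ℝ, c ≠ 0 ∧ C c * U ∈ intPoly σ ∧ len (C c * U) ≤ len (U * V) ∧
      ∃ b : σ →₀ ℕ, ∀ a, coeff a U ≠ 0 → coeff (a + b) (U * V) ≠ 0 := by
  classical
  obtain ⟨b, hb⟩ := ne_zero_iff.mp hV0
  have hbT := mem_supported_iff_coeff.mp hV b hb
  have key : ∀ a, coeff a U ≠ 0 → coeff (a + b) (U * V) = coeff b V * coeff a U := by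
    intro a ha
    rw [coeff_add_mul_of_disjoint hd hU hV (mem_supported_iff_coeff.mp hU a ha) hbT, mul_comm]
  refine ⟨coeff b V, hb, mem_intPoly_iff.mpr fun e => ?_, ?_, b, fun a ha => ?_⟩
  · rw [coeff_C_mul]
    by_cases he : coeff e U = 0
    · exact ⟨0, by simp [he]⟩
    · rw [← key e he]
      exact mem_intPoly_iff.mp hi _
  · have h1 : (C (coeff b V) * U).support = U.support := by
      ext e
      simp [coeff_C_mul, hb]
    rw [len, h1]
    have h2 := sum_abs_coeff_le_len (U * V) (U.support.map (addRightEmbedding b))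
    rw [Finset.sum_map] at h2
    refine le_trans (le_of_eq (Finset.sum_congr rfl fun e he => ?_)) h2
    rw [coeff_C_mul, addRightEmbedding_apply, key e (mem_support_iff.mp he)]
  · rw [key a ha]
    exact mul_ne_zero hb ha

end Determinant

section Numeric

lemma le_sum_max {k ρ : ℕ} (hk : k ≤ ρ + 1) (hρ : 1 ≤ ρ) {a : ℝ} (ha : 0 < a) (ha1 : a ≤ 1) :
    a ^ 2 * k / 8 ≤ ∑ i ∈ Finset.range k, max 0 (a - (i : ℝ) / ρ) := by
  have hρ' : (1 : ℝ) ≤ ρ := by exact_mod_cast hρ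
  have hk' : (k : ℝ) ≤ ρ + 1 := by exact_mod_cast hk
  set m := min k (⌊a * ρ / 2⌋₊ + 1) with hm
  have hmk : m ≤ k := min_le_left _ _
  have h1 : (m : ℝ) * (a / 2) ≤ ∑ i ∈ Finset.range k, max 0 (a - (i : ℝ) / ρ) := by
    calc (m : ℝ) * (a / 2) = ∑ i ∈ Finset.range m, a / 2 := by simp
      _ ≤ ∑ i ∈ Finset.range m, max 0 (a - (i : ℝ) / ρ) := by
        refine Finset.sum_le_sum fun i hi => le_max_of_le_right ?_
        have h2 : i < ⌊a * ρ / 2⌋₊ + 1 := (Finset.mem_range.mp hi).trans_le (min_le_right _ _)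
        have h3 : (i : ℝ) ≤ a * ρ / 2 :=
          (Nat.cast_le.mpr (Nat.lt_succ_iff.mp h2)).trans (Nat.floor_le (by positivity))
        have h4 : (i : ℝ) / ρ ≤ a / 2 := by
          rw [div_le_iff₀ (by linarith)]
          linarith
        linarith
      _ ≤ _ := Finset.sum_le_sum_of_subset_of_nonneg
        (Finset.range_subset_range.mpr hmk) fun _ _ _ => le_max_left _ _
  refine le_trans ?_ h1
  have h5 : a * k / 4 ≤ m := by
    rw [hm, Nat.cast_min, le_min_iff]
    constructor
    · nlinarith [Nat.cast_nonneg (α := ℝ) k]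
    · push_cast
      have := Nat.lt_floor_add_one (a * ρ / 2)
      nlinarith
  nlinarith

end Numeric

section RothLemma

lemma wt_eq_of_apply_eq_zero {σ : Type*} [Fintype σ] {r : σ → ℕ} {s : σ} {e : σ →₀ ℕ} (he : ∀ x, e x ≠ 0 → x = s) :
    wt r e = (e s : ℝ) / r s := by
  refine Finset.sum_eq_single s (fun b _ hb => ?_) (by simp)
  have : e b = 0 := by
    by_contra h
    exact hb (he b h)
  simp [this]

lemma shift_det {σ : Type*} (β : σ → ℝ) {k : ℕ} (M : Matrix (Fin k) (Fin k) (MvPolynomial σ ℝ)) :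
    shift β M.det = (M.map (shift β)).det :=
  AlgHom.map_det _ _

variable {σ : Type*} [LinearOrder σ]

lemma IsAdmissible.H_nonneg {ω : ℝ} {S : Finset σ} {r : σ → ℕ} {H : ℝ} {p q : σ → ℤ}
    {P : MvPolynomial σ ℝ} (h : IsAdmissible ω S r H p q P) (hω : 0 < ω) {s : σ} (hs : s ∈ S) :
    0 ≤ H :=
  nonneg_of_mul_nonneg_right ((Nat.cast_nonneg _).trans (h.r_le s hs)) hω

/-- The factors of a generalised Wronskian inherit admissibility, up to a scalar. -/
lemma IsAdmissible.exists_C_mul {ω ω' : ℝ} {S S' : Finset σ} {r : σ → ℕ} {H : ℝ} {p q : σ → ℤ}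
    {P : MvPolynomial σ ℝ} (h : IsAdmissible ω S r H p q P) (hS : S' ⊆ S) (hωω' : ω ≤ ω')
    (hH : 0 ≤ H) {k : ℕ} (hk : 0 < k) {T' : Set σ} (hd : Disjoint (S' : Set σ) T')
    {U V : MvPolynomial σ ℝ} (hU : U ∈ supported ℝ (S' : Set σ)) (hV : V ∈ supported ℝ T')
    (hU0 : U ≠ 0) (hV0 : V ≠ 0) (hi : U * V ∈ intPoly σ)
    (hdeg : ∀ x, degreeOf x (U * V) ≤ k * degreeOf x P)
    (hlen : Real.log (len (U * V)) ≤ k * (ω' * H)) :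
    ∃ c : ℝ, c ≠ 0 ∧ IsAdmissible ω' S' (fun x => k * r x) (k * H) p q (C c * U) := by
  obtain ⟨c, hc, hci, hcl, b, hb⟩ := exists_C_mul_mem_intPoly hd hU hV hV0 hi
  have hne : C c * U ≠ 0 := mul_ne_zero (by simpa using hc) hU0
  refine ⟨c, hc, fun x hx => Nat.mul_pos hk (h.r_pos x (hS hx)), fun x hx => h.q_pos x (hS hx),
    fun x hx => h.coprime x (hS hx), fun i hi j hj hij => ?_, fun x hx => ?_, fun x hx => ?_,
    hne, ?_, fun e he x hx => ?_, hci, ?_⟩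
  · push_cast
    have h1 := h.decay i (hS hi) j (hS hj) hij
    have h2 : (0 : ℝ) ≤ r i := Nat.cast_nonneg _
    calc (k : ℝ) * r j ≤ k * (ω' * r i) := by gcongr; nlinarith
      _ = _ := by ring
  · push_cast
    have h1 := h.r_le x (hS hx)
    calc (k : ℝ) * r x ≤ k * (ω' * H) := by gcongr; nlinarith
      _ = _ := by ring
  · push_cast
    rw [mul_assoc]
    exact mul_le_mul_of_nonneg_left (h.le_log x (hS hx)) (Nat.cast_nonneg _)
  · exact mul_mem (Subalgebra.algebraMap_mem _ c) hU
  · rw [mem_support_iff, coeff_C_mul] at he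
    have h1 := degreeOf_le_iff.mp (hdeg x) _ (mem_support_iff.mpr (hb e (right_ne_zero_of_mul he)))
    have h2 : degreeOf x P ≤ r x := degreeOf_le_iff.mpr fun e he => h.deg_le e he x (hS hx)
    rw [Finsupp.add_apply] at h1
    exact (Nat.le_add_right _ _).trans (h1.trans (Nat.mul_le_mul_left k h2))
  · refine (Real.log_le_log (len_pos hne) hcl).trans (hlen.trans (le_of_eq ?_))
    ring

variable [Fintype σ]

lemma IsAdmissible.sum_le {ω : ℝ} {S : Finset σ} {r : σ → ℕ} {H : ℝ} {p q : σ → ℤ}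
    {P : MvPolynomial σ ℝ} (h : IsAdmissible ω S r H p q P) :
    ∀ e ∈ P.support, ∑ x, e x ≤ ∑ x ∈ S, r x := by
  intro e he
  rw [← Finset.sum_subset (Finset.subset_univ S)]
  · exact Finset.sum_le_sum fun x hx => h.deg_le e he x hx
  · intro x _ hx
    by_contra hne
    exact hx (mem_supported_iff_coeff.mp h.supp e (mem_support_iff.mp he) x hne)

lemma IsAdmissible.log_len_det_le {ω : ℝ} {S : Finset σ} {r : σ → ℕ} {H : ℝ}
    {p q : σ → ℤ} {P : MvPolynomial σ ℝ} (h : IsAdmissible ω S r H p q P) {s : σ} (hs : s ∈ S)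
    {k : ℕ} (hk0 : 0 < k) (hk : k ≤ r s + 1) (Δ Θ : Fin k → σ →₀ ℕ)
    (hdet : (Matrix.of fun i l => hasse (Δ i) (hasse (Θ l) P)).det ≠ 0) :
    Real.log (len (Matrix.of fun i l => hasse (Δ i) (hasse (Θ l) P)).det) ≤
      k * (ω * (2 * S.card + 3) * H) := by
  set N := ∑ x ∈ S, r x with hN
  have hlen : 0 < len P := len_pos h.ne_zero
  have h1 : len (Matrix.of fun i l => hasse (Δ i) (hasse (Θ l) P)).det ≤
      (k * (2 ^ N * (2 ^ N * len P))) ^ k := by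
    refine len_det_le _ fun i l => ?_
    refine (len_hasse_le (N := N) _ ?_).trans
      (mul_le_mul_of_nonneg_left (len_hasse_le _ h.sum_le) (by positivity))
    intro e he
    rw [mem_support_iff, coeff_hasse] at he
    refine le_trans ?_ (h.sum_le (e + Θ l) (mem_support_iff.mpr (right_ne_zero_of_mul he)))
    exact Finset.sum_le_sum fun x _ => Nat.le_add_right _ _
  have hk' : (0 : ℝ) < k := by exact_mod_cast hk0
  refine (Real.log_le_log (len_pos hdet) h1).trans ?_
  rw [Real.log_pow, Real.log_mul hk'.ne' (by positivity), Real.log_mul (by positivity)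
    (by positivity), Real.log_mul (by positivity) hlen.ne', Real.log_pow]
  refine mul_le_mul_of_nonneg_left ?_ hk'.le
  have h2 : Real.log k ≤ 2 * (ω * H) := by
    have h3 := Real.log_le_sub_one_of_pos hk'
    have h4 := h.r_le s hs
    have h5 : (k : ℝ) ≤ r s + 1 := by exact_mod_cast hk
    have h6 : (0 : ℝ) ≤ r s := Nat.cast_nonneg _
    linarith
  have h7 : (N : ℝ) ≤ S.card * (ω * H) := by
    rw [hN]
    push_cast
    refine (Finset.sum_le_sum fun x hx => h.r_le x hx).trans ?_
    simp
  have h8 : (N : ℝ) * Real.log 2 ≤ N := by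
    have := Real.log_two_lt_d9
    nlinarith [Nat.cast_nonneg (α := ℝ) N]
  have h9 := h.log_len_le
  nlinarith

/-- If `P` vanishes to high order, then so do its generalised Wronskians. -/
lemma IsAdmissible.ordGE_shift_det {ω : ℝ} {s : σ} {T : Finset σ}
    (hsT : ∀ x ∈ T, x < s) {r : σ → ℕ} {H : ℝ} {p q : σ → ℤ} {P : MvPolynomial σ ℝ}
    (h : IsAdmissible ω (insert s T) r H p q P) {k : ℕ} (hk : k ≤ r s + 1)
    {Δ Θ : Fin k → σ →₀ ℕ} (hΔ : ∀ i, (Δ i).degree + i < k) (hΘ : ∀ i, (Θ i).degree + i < k)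
    (hΔT : ∀ i x, Δ i x ≠ 0 → x ∈ (T : Set σ)) (hΘs : ∀ i x, Θ i x ≠ 0 → x = s)
    {β : σ → ℝ} {ε a : ℝ} (ha : 0 < a) (ha1 : a ≤ 1) (haε : a + T.card * ω ≤ ε)
    (hP : OrdGE r ε (shift β P)) :
    OrdGE r (a ^ 2 * k / 8)
      (shift β (Matrix.of fun i l => hasse (Δ i) (hasse (Θ l) P)).det) := by
  have hrs := h.r_pos s (Finset.mem_insert_self _ _)
  have hrs' : (0 : ℝ) < r s := by exact_mod_cast hrs
  have hsum : a ^ 2 * k / 8 ≤ ∑ l : Fin k, max 0 (a - ((l.rev : ℕ) : ℝ) / r s) := by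
    refine (le_sum_max hk hrs ha ha1).trans (le_of_eq ?_)
    rw [Finset.sum_range fun i => max 0 (a - (i : ℝ) / r s)]
    exact (Equiv.sum_comp Fin.revPerm fun l : Fin k => max 0 (a - ((l : ℕ) : ℝ) / r s)).symm
  have hdeg : ∀ (e : σ →₀ ℕ) x, e x ≤ e.degree := fun e x => Finsupp.le_degree x e
  have hwtΔ : ∀ i, wt r (Δ i) ≤ T.card * ω := by
    intro i
    rw [wt, ← Finset.sum_subset (Finset.subset_univ T)]
    · rw [← nsmul_eq_mul]
      refine Finset.sum_le_card_nsmul _ _ _ fun x hx => ?_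
      have hrx : (0 : ℝ) < r x := by exact_mod_cast h.r_pos x (Finset.mem_insert_of_mem hx)
      rw [div_le_iff₀ hrx]
      refine le_trans ?_ (h.decay x (Finset.mem_insert_of_mem hx) s (Finset.mem_insert_self _ _)
        (hsT x hx))
      have h1 := hdeg (Δ i) x
      have h2 := hΔ i
      exact_mod_cast (by omega : Δ i x ≤ r s)
    · intro x _ hx
      have : Δ i x = 0 := by
        by_contra hne
        exact hx (hΔT i x hne)
      simp [this]
  have hwtΘ : ∀ l, wt r (Θ l) ≤ ((l.rev : ℕ) : ℝ) / r s := by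
    intro l
    rw [wt_eq_of_apply_eq_zero (hΘs l)]
    gcongr
    have h1 := hdeg (Θ l) s
    have h2 := hΘ l
    rw [Fin.val_rev]
    omega
  have hmain : OrdGE r (∑ l : Fin k, max 0 (a - ((l.rev : ℕ) : ℝ) / r s))
      (shift β (Matrix.of fun i l => hasse (Δ i) (hasse (Θ l) P)).det) := by
    rw [shift_det]
    refine OrdGE.det fun i l => ?_
    simp only [Matrix.map_apply, Matrix.of_apply]
    rw [← hasse_shift, ← hasse_shift]
    intro e he
    refine max_le (wt_nonneg r e) ?_
    have h1 := (hP.hasse (Θ l)).hasse (Δ i) e he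
    have h2 := hwtΔ i
    have h3 := hwtΘ l
    linarith
  exact fun e he => hsum.trans (hmain e he)

end RothLemma

/-- Roth's lemma: a polynomial with small integer coefficients cannot vanish to high order at a
rational point whose coordinates have rapidly increasing heights. -/
theorem exists_wt_le_of_isAdmissible {σ : Type*} [LinearOrder σ] [Fintype σ] (S : Finset σ) :
    ∀ ε : ℝ, 0 < ε → ∃ ω : ℝ, 0 < ω ∧ ∀ r H p q P, IsAdmissible ω S r H p q P →
      ∃ e, coeff e (shift (fun x => (p x : ℝ) / q x) P) ≠ 0 ∧ wt r e ≤ ε := by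
  induction S using Finset.induction_on_max with
  | empty =>
    intro ε hε
    refine ⟨1, one_pos, fun r H p q P h => ?_⟩
    obtain ⟨e, he⟩ := ne_zero_iff.mp (shift_ne_zero (fun x => (p x : ℝ) / q x) h.ne_zero)
    have he0 : e = 0 := by
      ext x
      by_contra hne
      have := mem_supported_iff_coeff.mp (shift_mem_supported _ h.supp) e he x hne
      simp at this
    exact ⟨e, he, by simpa [he0] using hε.le⟩
  | insert s T hsT ih =>
    intro ε hε
    set ε₁ := min ε 1 with hε₁
    have hε₁0 : 0 < ε₁ := lt_min hε one_pos
    have hε₁1 : ε₁ ≤ 1 := min_le_right _ _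
    set ε' := ε₁ ^ 2 / 100 with hε'
    have hε'0 : 0 < ε' := by positivity
    obtain ⟨ω', hω'0, hω'⟩ := ih ε' hε'0
    set c : ℝ := 2 * T.card + 5 with hc
    have hcT : (0 : ℝ) ≤ T.card := Nat.cast_nonneg _
    have hc0 : 0 < c := by positivity
    set ω := min ω' ε' / c with hω
    have hω0 : 0 < ω := div_pos (lt_min hω'0 hε'0) hc0
    have hωc : ω * c = min ω' ε' := div_mul_cancel₀ _ hc0.ne'
    have hωcω' : ω * c ≤ ω' := hωc.trans_le (min_le_left _ _)
    have hωcε' : ω * c ≤ ε' := hωc.trans_le (min_le_right _ _)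
    have hωω : ω ≤ ω * c := le_mul_of_one_le_right hω0.le (by linarith)
    refine ⟨ω, hω0, fun r H p q P h => ?_⟩
    by_contra! hcon
    set β : σ → ℝ := fun x => (p x : ℝ) / q x with hβ
    have hsS : s ∈ insert s T := Finset.mem_insert_self _ _
    have hs : s ∉ T := fun h => lt_irrefl _ (hsT s h)
    have hH := h.H_nonneg hω0 hsS
    have hdisj : Disjoint (T : Set σ) {s} := by simpa using hs
    obtain ⟨k, hk0, hk, U, hU, V, hV, Δ, Θ, hU0, hV0, hΔ, hΘ, hΔT, hΘs, hW⟩ :=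
      exists_generalized_wronskian (T := (T : Set σ)) (s := s) (by simpa using hs) h.ne_zero
        (by simpa using h.supp) (fun e he => h.deg_le e he s hsS)
    have hk0' : (0 : ℝ) < k := by exact_mod_cast hk0
    have hint : U * V ∈ intPoly σ := by
      rw [hW]
      exact det_mem_intPoly fun i j => hasse_mem_intPoly (hasse_mem_intPoly h.int _) _
    have hdeg : ∀ x, degreeOf x (U * V) ≤ k * degreeOf x P := by
      intro x
      rw [hW]
      exact degreeOf_det_le fun i j => (degreeOf_hasse_le _ _ _).trans (degreeOf_hasse_le _ _ _)
    have hlen : Real.log (len (U * V)) ≤ k * (ω * c * H) := by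
      have h1 := h.log_len_det_le hsS hk0 hk Δ Θ (hW ▸ mul_ne_zero hU0 hV0)
      rw [← hW, Finset.card_insert_of_notMem hs] at h1
      refine h1.trans (le_of_eq ?_)
      rw [hc]
      push_cast
      ring
    obtain ⟨c₁, hc₁, hU'⟩ := h.exists_C_mul (Finset.subset_insert s T) (hωω.trans hωcω') hH hk0
      hdisj hU hV hU0 hV0 hint hdeg (hlen.trans (by gcongr))
    obtain ⟨c₂, hc₂, hV'⟩ := h.exists_C_mul (S' := {s}) (T' := (T : Set σ)) (by simp)
      (hωω.trans hωcε') hH hk0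
      (by simpa using hs) (by simpa using hV) hU hV0 hU0 (mul_comm U V ▸ hint)
      (mul_comm U V ▸ hdeg) (mul_comm U V ▸ hlen.trans (by gcongr))
    obtain ⟨I, hI, hIwt⟩ := hω' _ _ _ _ _ hU'
    obtain ⟨J, hJ, hJwt⟩ := exists_wt_le_of_isAdmissible_singleton hε'0 hV'
    have hsC : ∀ a : ℝ, shift β (C a) = C a := fun a => by
      rw [← algebraMap_eq]
      exact AlgHom.commutes _ _
    rw [map_mul, hsC, coeff_C_mul] at hI hJ
    replace hI := right_ne_zero_of_mul hI
    replace hJ := right_ne_zero_of_mul hJ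
    have hUs := shift_mem_supported β hU
    have hVs := shift_mem_supported β hV
    have hIJ : coeff (I + J) (shift β (U * V)) ≠ 0 := by
      rw [map_mul, coeff_add_mul_of_disjoint hdisj hUs hVs (mem_supported_iff_coeff.mp hUs I hI)
        (mem_supported_iff_coeff.mp hVs J hJ)]
      exact mul_ne_zero hI hJ
    have hTω : T.card * ω ≤ ε' := by
      refine le_trans ?_ hωcε'
      rw [hc]
      nlinarith
    have ha : ε₁ - ε' ≥ 99 / 100 * ε₁ := by
      rw [hε']
      nlinarith
    have hord := h.ordGE_shift_det hsT hk hΔ hΘ hΔT hΘs (β := β) (ε := ε) (a := 99 / 100 * ε₁)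
      (by positivity) (by linarith) (by linarith [min_le_left ε 1])
      (fun e he => (hcon e he).le)
    rw [← hW] at hord
    have h1 := hord _ hIJ
    rw [wt_add, wt_mul hk0, wt_mul hk0 r J] at h1
    have h2 : k * wt (fun x => k * r x) I ≤ k * ε' := by gcongr
    have h3 : k * wt (fun x => k * r x) J ≤ k * ε' := by gcongr
    have h4 : 0 < ε₁ ^ 2 * k := by positivity
    have h5 : k * ε' = ε₁ ^ 2 * k / 100 := by rw [hε']; ring
    nlinarith

/-- Powers of an algebraic integer are integer combinations of finitely many fixed reals, with
coefficients of at most exponential growth. -/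
lemma exists_pow_eq_sum {α : ℝ} (hα : IsIntegral ℤ α) :
    ∃ (d : ℕ) (b : Fin d → ℝ) (A : ℝ), 1 ≤ A ∧
      ∀ n : ℕ, ∃ c : Fin d → ℤ, α ^ n = ∑ l, c l * b l ∧ ∀ l, |(c l : ℝ)| ≤ A ^ (n + 1) := by
  obtain ⟨d, b, hb⟩ := Submodule.fg_iff_exists_fin_generating_family.mp hα.fg_adjoin_singleton
  have hmem : ∀ x ∈ Algebra.adjoin ℤ {α}, ∃ c : Fin d → ℤ, ∑ i, c i * b i = x := by
    intro x hx
    have h1 : x ∈ Submodule.span ℤ (Set.range b) := by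
      rw [hb]
      exact hx
    obtain ⟨c, hc⟩ := (Submodule.mem_span_range_iff_exists_fun ℤ).mp h1
    exact ⟨c, by simpa using hc⟩
  have hbmem : ∀ l, b l ∈ Algebra.adjoin ℤ {α} := fun l => by
    rw [← Subalgebra.mem_toSubmodule, ← hb]
    exact Submodule.subset_span ⟨l, rfl⟩
  have hαmem : α ∈ Algebra.adjoin ℤ {α} := Algebra.subset_adjoin rfl
  obtain ⟨c₀, hc₀⟩ := hmem 1 (one_mem _)
  choose M hM using fun l => hmem (α * b l) (mul_mem hαmem (hbmem l))
  set A : ℝ := 1 + ∑ l, |(c₀ l : ℝ)| + ∑ l, ∑ j, |(M l j : ℝ)| with hA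
  have hA1 : 1 ≤ A := by
    rw [hA, add_assoc]
    exact le_add_of_nonneg_right (by positivity)
  refine ⟨d, b, A, hA1, fun n => ?_⟩
  induction n with
  | zero =>
    refine ⟨c₀, by rw [pow_zero, hc₀], fun l => ?_⟩
    have h1 := Finset.single_le_sum (f := fun l => |(c₀ l : ℝ)|) (fun i _ => abs_nonneg _)
      (Finset.mem_univ l)
    have h2 : 0 ≤ ∑ l, ∑ j, |(M l j : ℝ)| := by positivity
    rw [zero_add, pow_one, hA]
    linarith
  | succ n ih =>
    obtain ⟨c, hc, hcA⟩ := ih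
    refine ⟨fun j => ∑ l, c l * M l j, ?_, fun j => ?_⟩
    · rw [pow_succ', hc, Finset.mul_sum]
      push_cast
      simp only [Finset.sum_mul]
      rw [Finset.sum_comm]
      refine Finset.sum_congr rfl fun l _ => ?_
      rw [mul_left_comm, ← hM l, Finset.mul_sum]
      exact Finset.sum_congr rfl fun j _ => by ring
    · have hA0 : 0 ≤ A ^ (n + 1) := by positivity
      push_cast
      calc |∑ l, (c l : ℝ) * M l j| ≤ ∑ l, |(c l : ℝ) * M l j| := Finset.abs_sum_le_sum_abs _ _
        _ ≤ ∑ l, A ^ (n + 1) * ∑ j, |(M l j : ℝ)| := by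
          refine Finset.sum_le_sum fun l _ => ?_
          rw [abs_mul]
          exact mul_le_mul (hcA l) (Finset.single_le_sum (f := fun j => |(M l j : ℝ)|)
            (fun i _ => abs_nonneg _) (Finset.mem_univ j)) (abs_nonneg _) hA0
        _ = A ^ (n + 1) * ∑ l, ∑ j, |(M l j : ℝ)| := by rw [Finset.mul_sum]
        _ ≤ A ^ (n + 1) * A := by
          refine mul_le_mul_of_nonneg_left ?_ hA0
          have h2 : 0 ≤ ∑ l, |(c₀ l : ℝ)| := by positivity
          linarith
        _ = A ^ (n + 1 + 1) := (pow_succ _ _).symm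

section Counting

lemma sum_exp_le {ρ : ℕ} (hρ : 0 < ρ) (t : ℝ) :
    ∑ j ∈ Finset.range (ρ + 1), Real.exp (t * (1 / 2 - j / ρ)) ≤
      (ρ + 1) * Real.exp (t ^ 2 / 8) := by
  have hρ' : (0 : ℝ) < ρ := by exact_mod_cast hρ
  have h1 : ∑ j ∈ Finset.range (ρ + 1), Real.exp (t * (1 / 2 - j / ρ)) =
      ∑ j ∈ Finset.range (ρ + 1), Real.exp (-(t * (1 / 2 - j / ρ))) := by
    rw [← Finset.sum_range_reflect]
    refine Finset.sum_congr rfl fun j hj => ?_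
    have hj' : j ≤ ρ := Nat.lt_succ_iff.mp (Finset.mem_range.mp hj)
    congr 1
    rw [Nat.add_sub_cancel, Nat.cast_sub hj']
    field_simp
    ring
  have h2 : ∑ j ∈ Finset.range (ρ + 1), Real.exp (t * (1 / 2 - j / ρ)) =
      ∑ j ∈ Finset.range (ρ + 1), Real.cosh (t * (1 / 2 - j / ρ)) := by
    simp only [Real.cosh_eq]
    rw [← Finset.sum_div, Finset.sum_add_distrib, ← h1]
    ring
  rw [h2]
  calc ∑ j ∈ Finset.range (ρ + 1), Real.cosh (t * (1 / 2 - j / ρ))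
      ≤ ∑ j ∈ Finset.range (ρ + 1), Real.exp (t ^ 2 / 8) := by
        refine Finset.sum_le_sum fun j hj => ?_
        refine (Real.cosh_le_exp_half_sq _).trans (Real.exp_le_exp.mpr ?_)
        have hj' : (j : ℝ) ≤ ρ := by
          exact_mod_cast Nat.lt_succ_iff.mp (Finset.mem_range.mp hj)
        have h3 : (j : ℝ) / ρ ≤ 1 := (div_le_one hρ').mpr hj'
        have h4 : (0 : ℝ) ≤ j / ρ := by positivity
        have h5 : (1 / 2 - (j : ℝ) / ρ) ^ 2 ≤ 1 / 4 := by nlinarith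
        rw [mul_pow]
        nlinarith [sq_nonneg t]
    _ = _ := by simp

/-- Few points of a box have coordinate sum far below the mean. -/
lemma card_filter_le {m : ℕ} {r : Fin m → ℕ} (hr : ∀ h, 0 < r h) {ε : ℝ} (hε : 0 < ε) :
    (((Fintype.piFinset fun h => Finset.range (r h + 1)).filter
      fun f => ∑ h, (f h : ℝ) / r h ≤ m * (1 / 2 - ε)).card : ℝ) ≤
      (∏ h, ((r h : ℝ) + 1)) * Real.exp (-(2 * m * ε ^ 2)) := by
  set box := Fintype.piFinset fun h => Finset.range (r h + 1) with hbox
  set t := 4 * ε with ht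
  have h1 : ∀ f : Fin m → ℕ, Real.exp (t * (m * (1 / 2 - ε) - ∑ h, (f h : ℝ) / r h)) =
      Real.exp (-(t * m * ε)) * ∏ h, Real.exp (t * (1 / 2 - (f h : ℝ) / r h)) := by
    intro f
    rw [← Real.exp_sum, ← Real.exp_add, ← Finset.mul_sum, Finset.sum_sub_distrib]
    congr 1
    simp
    ring
  calc ((box.filter fun f => ∑ h, (f h : ℝ) / r h ≤ m * (1 / 2 - ε)).card : ℝ)
      = ∑ f ∈ box.filter fun f => ∑ h, (f h : ℝ) / r h ≤ m * (1 / 2 - ε), (1 : ℝ) := by simp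
    _ ≤ ∑ f ∈ box.filter fun f => ∑ h, (f h : ℝ) / r h ≤ m * (1 / 2 - ε),
        Real.exp (t * (m * (1 / 2 - ε) - ∑ h, (f h : ℝ) / r h)) := by
      refine Finset.sum_le_sum fun f hf => Real.one_le_exp ?_
      have := (Finset.mem_filter.mp hf).2
      exact mul_nonneg (by positivity) (by linarith)
    _ ≤ ∑ f ∈ box, Real.exp (t * (m * (1 / 2 - ε) - ∑ h, (f h : ℝ) / r h)) :=
      Finset.sum_le_sum_of_subset_of_nonneg (Finset.filter_subset _ _)
        fun _ _ _ => (Real.exp_pos _).le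
    _ = Real.exp (-(t * m * ε)) * ∏ h, ∑ j ∈ Finset.range (r h + 1),
        Real.exp (t * (1 / 2 - (j : ℝ) / r h)) := by
      simp only [h1]
      rw [← Finset.mul_sum, Finset.prod_univ_sum]
    _ ≤ Real.exp (-(t * m * ε)) * ∏ h, (((r h : ℝ) + 1) * Real.exp (t ^ 2 / 8)) := by
      refine mul_le_mul_of_nonneg_left ?_ (Real.exp_pos _).le
      exact Finset.prod_le_prod (fun h _ => Finset.sum_nonneg fun _ _ => (Real.exp_pos _).le)
        fun h _ => sum_exp_le (hr h) t
    _ = _ := by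
      rw [Finset.prod_mul_distrib, mul_left_comm, Finset.prod_const, ← Real.exp_nat_mul,
        ← Real.exp_add]
      congr 2
      simp [ht]
      ring

end Counting

section Auxiliary

lemma hasse_monomial {σ : Type*} [Fintype σ] {Δ e : σ →₀ ℕ} (h : Δ ≤ e) (c : ℝ) :
    hasse Δ (monomial e c) = monomial (e - Δ) (multichoose (e - Δ) Δ * c) := by
  classical
  ext J
  rw [coeff_hasse, coeff_monomial, coeff_monomial]
  by_cases hJ : e - Δ = J
  · rw [if_pos hJ, if_pos (by rw [← hJ, tsub_add_cancel_of_le h]), hJ]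
  · rw [if_neg hJ, if_neg fun h2 => hJ (by rw [h2, add_tsub_cancel_right]), mul_zero]

lemma hasse_monomial_of_not_le {σ : Type*} [Fintype σ] {Δ e : σ →₀ ℕ} (h : ¬ Δ ≤ e) (c : ℝ) :
    hasse Δ (monomial e c) = 0 := by
  classical
  ext J
  rw [coeff_hasse, coeff_monomial, if_neg, mul_zero, coeff_zero]
  rintro rfl
  exact h le_add_self

lemma exists_coeff_shift_monomial_eq_sum {σ : Type*} [Fintype σ] {α A : ℝ} {d : ℕ} {b : Fin d → ℝ}
    (hA : 1 ≤ A)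
    (hb : ∀ n : ℕ, ∃ c : Fin d → ℤ, α ^ n = ∑ l, c l * b l ∧ ∀ l, |(c l : ℝ)| ≤ A ^ (n + 1))
    (I e : σ →₀ ℕ) {N : ℕ} (hN : ∑ h, e h ≤ N) :
    ∃ c : Fin d → ℤ, coeff I (shift (fun _ => α) (monomial e 1)) = ∑ l, c l * b l ∧
      ∀ l, |(c l : ℝ)| ≤ 2 ^ N * A ^ (N + 1) := by
  rw [coeff_shift]
  by_cases h : I ≤ e
  · rw [hasse_monomial h, eval_monomial, mul_one, Finsupp.prod, Finset.prod_pow_eq_pow_sum]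
    obtain ⟨c, hc, hcA⟩ := hb (∑ x ∈ (e - I).support, (e - I) x)
    refine ⟨fun l => multichoose (e - I) I * c l, ?_, fun l => ?_⟩
    · rw [hc, Finset.mul_sum]
      push_cast
      exact Finset.sum_congr rfl fun l _ => (mul_assoc _ _ _).symm
    · push_cast
      rw [abs_mul, Nat.abs_cast]
      refine mul_le_mul ?_ ((hcA l).trans ?_) (abs_nonneg _) (by positivity)
      · have h1 := multichoose_le (e - I) I
        rw [tsub_add_cancel_of_le h] at h1
        exact_mod_cast h1.trans (Nat.pow_le_pow_right (by norm_num) hN)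
      · refine pow_le_pow_right₀ hA (Nat.succ_le_succ (le_trans ?_ hN))
        refine (Finset.sum_le_sum_of_subset (Finset.subset_univ _)).trans
          (Finset.sum_le_sum fun x _ => ?_)
        rw [Finsupp.tsub_apply]
        exact Nat.sub_le _ _
  · exact ⟨0, by simp [hasse_monomial_of_not_le h], fun l => by simp; positivity⟩

/-- Siegel's lemma in the shape needed here. -/
lemma exists_int_vec {ι κ : Type*} [Fintype ι] [Fintype κ] (M : Matrix ι κ ℤ)
    (hι : 0 < Fintype.card ι) (hκ : 2 * Fintype.card ι ≤ Fintype.card κ) {E : ℝ} (hE : 1 ≤ E)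
    (hM : ∀ i j, |(M i j : ℝ)| ≤ E) :
    ∃ t : κ → ℤ, t ≠ 0 ∧ M.mulVec t = 0 ∧ ∀ j, |(t j : ℝ)| ≤ Fintype.card κ * E := by
  obtain ⟨t, ht0, ht, hn⟩ := Int.Matrix.exists_ne_zero_int_vec_norm_le M (by omega) hι
  refine ⟨t, ht0, ht, fun j => ?_⟩
  have h1 : (1 : ℝ) ≤ Fintype.card κ := by exact_mod_cast (by omega : 1 ≤ Fintype.card κ)
  have h2 : (2 : ℝ) * Fintype.card ι ≤ Fintype.card κ := by exact_mod_cast hκ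
  have h3 : (0 : ℝ) < Fintype.card ι := by exact_mod_cast hι
  rw [← Int.norm_eq_abs]
  refine (norm_le_pi_norm t j).trans (hn.trans ?_)
  refine (Real.rpow_le_rpow_of_exponent_le ?_ ((div_le_one (by linarith)).mpr (by linarith))).trans
    ?_
  · exact one_le_mul_of_one_le_of_one_le h1 (le_max_left _ _)
  · rw [Real.rpow_one]
    refine mul_le_mul_of_nonneg_left (max_le hE ?_) (by linarith)
    exact (Matrix.norm_le_iff (by linarith)).mpr fun i j => by
      rw [Int.norm_eq_abs]
      exact hM i j

lemma exists_exp_le (d : ℕ) {ε : ℝ} (hε : 0 < ε) :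
    ∃ m₀ : ℕ, ∀ m ≥ m₀, 2 * d * Real.exp (-(2 * m * ε ^ 2)) ≤ 1 := by
  obtain ⟨m₀, hm₀⟩ := exists_nat_gt (Real.log (2 * d + 1) / (2 * ε ^ 2))
  refine ⟨m₀, fun m hm => ?_⟩
  have h1 : Real.log (2 * d + 1) ≤ 2 * m * ε ^ 2 := by
    rw [div_lt_iff₀ (by positivity)] at hm₀
    have : (m₀ : ℝ) ≤ m := by exact_mod_cast hm
    nlinarith [sq_nonneg ε]
  rw [Real.log_le_iff_le_exp (by positivity)] at h1
  rw [Real.exp_neg, ← div_eq_mul_inv, div_le_one (Real.exp_pos _)]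
  linarith

/-- The auxiliary polynomial, vanishing to high weighted order at `(α, …, α)`. -/
theorem exists_auxiliary {α : ℝ} (hα : IsIntegral ℤ α) :
    ∃ B : ℝ, 1 ≤ B ∧ ∀ ε : ℝ, 0 < ε → ε ≤ 1 / 2 → ∃ m₀ : ℕ, ∀ m ≥ m₀, 0 < m → ∀ r : Fin m → ℕ,
      (∀ h, 0 < r h) → ∃ P : MvPolynomial (Fin m) ℝ, P ≠ 0 ∧ P ∈ intPoly (Fin m) ∧
        (∀ e ∈ P.support, ∀ h, e h ≤ r h) ∧ len P ≤ B ^ ∑ h, r h ∧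
        OrdGE r (m * (1 / 2 - ε)) (shift (fun _ => α) P) := by
  classical
  obtain ⟨d, b, A, hA, hb⟩ := exists_pow_eq_sum hα
  have hd : 0 < d := by
    rcases Nat.eq_zero_or_pos d with rfl | hd
    · obtain ⟨c, hc, -⟩ := hb 0
      simp at hc
    · exact hd
  refine ⟨8 * A ^ 2, by nlinarith, fun ε hε hε2 => ?_⟩
  obtain ⟨m₀, hm₀⟩ := exists_exp_le d hε
  refine ⟨m₀, fun m hm hm0 r hr => ?_⟩
  set N := ∑ h, r h with hN
  have hN1 : 1 ≤ N := (hr ⟨0, hm0⟩).trans_le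
    (Finset.single_le_sum (fun _ _ => Nat.zero_le _) (Finset.mem_univ _))
  set box := Fintype.piFinset fun h => Finset.range (r h + 1) with hbox
  set G := box.filter fun f => ∑ h, (f h : ℝ) / r h ≤ m * (1 / 2 - ε) with hG
  have hbox_card : box.card = ∏ h, (r h + 1) := by
    rw [hbox, Fintype.card_piFinset]
    simp
  have hG0 : (0 : Fin m → ℕ) ∈ G := by
    rw [hG, Finset.mem_filter, hbox, Fintype.mem_piFinset]
    refine ⟨fun h => by simp, ?_⟩
    simp only [Pi.zero_apply, Nat.cast_zero, zero_div, Finset.sum_const_zero]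
    exact mul_nonneg (Nat.cast_nonneg _) (by linarith)
  set toF : (Fin m → ℕ) → (Fin m →₀ ℕ) :=
    ⇑(Finsupp.equivFunOnFinite (α := Fin m) (M := ℕ)).symm with htoF
  have hmem_box : ∀ f ∈ box, ∀ h, f h ≤ r h := fun f hf h => by
    have := Fintype.mem_piFinset.mp hf h
    exact Nat.lt_succ_iff.mp (Finset.mem_range.mp this)
  have hsum_box : ∀ f ∈ box, ∑ h, toF f h ≤ N := fun f hf =>
    Finset.sum_le_sum fun h _ => hmem_box f hf h
  choose c hc hcA using fun (I : Fin m → ℕ) (e : box) =>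
    exists_coeff_shift_monomial_eq_sum hA hb (toF I) (toF e) (hsum_box e e.2)
  have hE1 : (1 : ℝ) ≤ 2 ^ N * A ^ (N + 1) :=
    one_le_mul_of_one_le_of_one_le (one_le_pow₀ (by norm_num)) (one_le_pow₀ hA)
  obtain ⟨t, ht0, ht, htn⟩ := exists_int_vec
    (Matrix.of fun (i : G × Fin d) (e : box) => c i.1 e i.2)
    (by
      rw [Fintype.card_prod, Fintype.card_coe, Fintype.card_fin]
      exact Nat.mul_pos (Finset.card_pos.mpr ⟨_, hG0⟩) hd)
    (by
      rw [Fintype.card_prod, Fintype.card_coe, Fintype.card_fin, Fintype.card_coe]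
      have h1 := card_filter_le hr hε
      rw [← hbox, ← hG] at h1
      have h2 := hm₀ m hm
      have h3 : ((box.card : ℕ) : ℝ) = ∏ h, ((r h : ℝ) + 1) := by
        rw [hbox_card]
        push_cast
        rfl
      rw [← h3] at h1
      have h4 : (2 : ℝ) * (G.card * d) ≤ box.card := by
        have h5 : (0 : ℝ) ≤ box.card := Nat.cast_nonneg _
        calc (2 : ℝ) * (G.card * d) = 2 * d * G.card := by ring
          _ ≤ 2 * d * (box.card * Real.exp (-(2 * m * ε ^ 2))) := by gcongr
          _ = box.card * (2 * d * Real.exp (-(2 * m * ε ^ 2))) := by ring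
          _ ≤ box.card * 1 := by gcongr
          _ = box.card := mul_one _
      exact_mod_cast h4)
    hE1 (fun i e => hcA i.1 e i.2)
  set P : MvPolynomial (Fin m) ℝ := ∑ e : box, monomial (toF e) (t e : ℝ) with hP
  have htoF_inj : Function.Injective toF := Equiv.injective _
  have hcoeff : ∀ e : box, coeff (toF e) P = t e := by
    intro e
    rw [hP, coeff_sum, Finset.sum_eq_single e]
    · simp
    · intro f _ hf
      rw [coeff_monomial, if_neg fun h => hf (Subtype.ext (htoF_inj h))]
    · simp
  have hsupp : ∀ e ∈ P.support, ∃ f : box, toF f = e := by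
    intro e he
    rw [mem_support_iff, hP, coeff_sum] at he
    obtain ⟨f, -, hf⟩ := Finset.exists_ne_zero_of_sum_ne_zero he
    rw [coeff_monomial] at hf
    exact ⟨f, by by_contra h; simp [h] at hf⟩
  have hshift : ∀ I, coeff I (shift (fun _ => α) P) =
      ∑ e : box, (t e : ℝ) * coeff I (shift (fun _ => α) (monomial (toF e) 1)) := by
    intro I
    rw [hP, map_sum, coeff_sum]
    refine Finset.sum_congr rfl fun e _ => ?_
    rw [show monomial (toF e) (t e : ℝ) = (t e : ℝ) • monomial (toF e) (1 : ℝ) by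
      rw [smul_monomial, smul_eq_mul, mul_one], map_smul, coeff_smul, smul_eq_mul]
  refine ⟨P, ?_, ?_, ?_, ?_, ?_⟩
  · intro h0
    refine ht0 (funext fun e => ?_)
    have := hcoeff e
    rw [h0, coeff_zero] at this
    exact_mod_cast this.symm
  · refine sum_mem fun e _ => mem_intPoly_iff.mpr fun f => ?_
    rw [coeff_monomial]
    split_ifs
    · exact ⟨_, rfl⟩
    · exact ⟨0, by simp⟩
  · intro e he h
    obtain ⟨f, rfl⟩ := hsupp e he
    exact hmem_box f f.2 h
  · have h1 : (box.card : ℝ) ≤ 2 ^ N := by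
      rw [hbox_card, hN, ← Finset.prod_pow_eq_pow_sum]
      push_cast
      refine Finset.prod_le_prod (fun h _ => by positivity) fun h _ => ?_
      exact_mod_cast Nat.lt_two_pow_self (n := r h)
    have hA0 : 0 ≤ A := by linarith
    calc len P ≤ ∑ e : box, len (monomial (toF e) (t e : ℝ)) := len_sum_le _ _
      _ ≤ ∑ e : box, (box.card * (2 ^ N * A ^ (N + 1)) : ℝ) := by
        refine Finset.sum_le_sum fun e _ => ?_
        rw [len_monomial]
        simpa using htn e
      _ = box.card * (box.card * (2 ^ N * A ^ (N + 1))) := by simp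
      _ ≤ 2 ^ N * (2 ^ N * (2 ^ N * A ^ (2 * N))) := by
        gcongr
        omega
      _ = (8 * A ^ 2) ^ N := by
        rw [mul_pow, ← pow_mul, show (8 : ℝ) = 2 * (2 * 2) by norm_num, mul_pow, mul_pow]
        ring
  · intro I hI
    by_contra! hlt
    apply hI
    rw [hshift]
    by_cases hbx : (I : Fin m → ℕ) ∈ box
    · have hIG : (I : Fin m → ℕ) ∈ G := Finset.mem_filter.mpr ⟨hbx, hlt.le⟩
      have hI' : toF I = I := Finsupp.equivFunOnFinite.symm_apply_apply I
      have h1 : ∀ l, ∑ e : box, (c I e l : ℝ) * t e = 0 := by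
        intro l
        have := congrFun ht (⟨I, hIG⟩, l)
        simp only [Matrix.mulVec, dotProduct, Matrix.of_apply, Pi.zero_apply] at this
        exact_mod_cast this
      calc ∑ e : box, (t e : ℝ) * coeff I (shift (fun _ => α) (monomial (toF e) 1))
          = ∑ e : box, ∑ l, (c I e l * t e) * b l := by
            refine Finset.sum_congr rfl fun e _ => ?_
            have h2 := hc I e
            rw [hI'] at h2
            rw [h2, Finset.mul_sum]
            exact Finset.sum_congr rfl fun l _ => by ring
        _ = ∑ l, (∑ e : box, (c I e l : ℝ) * t e) * b l := by
            rw [Finset.sum_comm]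
            simp only [Finset.sum_mul]
        _ = 0 := Finset.sum_eq_zero fun l _ => by rw [h1, zero_mul]
    · refine Finset.sum_eq_zero fun e _ => ?_
      rw [coeff_shift, hasse_monomial_of_not_le, map_zero, mul_zero]
      intro hle
      refine hbx (Fintype.mem_piFinset.mpr fun h => Finset.mem_range.mpr ?_)
      exact Nat.lt_succ_iff.mpr ((hle h).trans (hmem_box e e.2 h))

end Auxiliary

section Approximation

variable {σ : Type*} [Fintype σ]

/-- A nonzero value of an integer polynomial at a rational point is bounded below in terms of the
denominators. -/
lemma one_le_prod_mul_abs_eval {Q : MvPolynomial σ ℝ} (hQ : Q ∈ intPoly σ) {r : σ → ℕ}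
    (hr : ∀ e ∈ Q.support, ∀ h, e h ≤ r h) {p q : σ → ℤ} (hq : ∀ h, 0 < q h)
    (h0 : eval (fun h => (p h : ℝ) / q h) Q ≠ 0) :
    1 ≤ (∏ h, (q h : ℝ) ^ r h) * |eval (fun h => (p h : ℝ) / q h) Q| := by
  have hq' : ∀ h, (0 : ℝ) < q h := fun h => by exact_mod_cast hq h
  have hmem : (∏ h, (q h : ℝ) ^ r h) * eval (fun h => (p h : ℝ) / q h) Q ∈
      (Int.castRingHom ℝ).range := by
    rw [eval_eq', Finset.mul_sum]
    refine sum_mem fun e he => ?_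
    obtain ⟨z, hz⟩ := mem_intPoly_iff.mp hQ e
    refine ⟨z * ∏ h, (p h ^ e h * q h ^ (r h - e h)), ?_⟩
    rw [hz, mul_left_comm, ← Finset.prod_mul_distrib]
    simp only [eq_intCast]
    push_cast
    congr 1
    refine Finset.prod_congr rfl fun h _ => ?_
    rw [← Nat.add_sub_of_le (hr e he h), pow_add, Nat.add_sub_cancel_left, div_pow]
    have := (hq' h).ne'
    field_simp
  obtain ⟨z, hz⟩ := hmem
  have hpos : 0 < ∏ h, (q h : ℝ) ^ r h := Finset.prod_pos fun h _ => pow_pos (hq' h) _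
  rw [← abs_of_pos hpos, ← abs_mul, ← hz]
  have hz0 : z ≠ 0 := by
    rintro rfl
    rw [map_zero] at hz
    exact mul_ne_zero hpos.ne' h0 hz.symm
  rw [eq_intCast]
  exact_mod_cast Int.one_le_abs hz0

lemma abs_eval_le_of_ordGE {F : MvPolynomial σ ℝ} {r : σ → ℕ} (hr : ∀ h, 0 < r h) {θ : ℝ}
    (hF : OrdGE r θ F) {x ℓ : σ → ℝ} {κ R : ℝ} (hκ : 0 ≤ κ) (hR : 0 ≤ R)
    (hx : ∀ h, |x h| ≤ Real.exp (-(κ * ℓ h))) (hℓ : ∀ h, R ≤ r h * ℓ h) :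
    |eval x F| ≤ len F * Real.exp (-(κ * R * θ)) := by
  rw [eval_eq', len, Finset.sum_mul]
  refine (Finset.abs_sum_le_sum_abs _ _).trans (Finset.sum_le_sum fun e he => ?_)
  rw [abs_mul, Finset.abs_prod]
  refine mul_le_mul_of_nonneg_left ?_ (abs_nonneg _)
  calc ∏ h, |x h ^ e h| ≤ ∏ h, Real.exp (-(κ * R * (e h / r h))) := by
        refine Finset.prod_le_prod (fun _ _ => abs_nonneg _) fun h _ => ?_
        rw [abs_pow]
        refine (pow_le_pow_left₀ (abs_nonneg _) (hx h) _).trans ?_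
        rw [← Real.exp_nat_mul, Real.exp_le_exp]
        have hrh : (0 : ℝ) < r h := by exact_mod_cast hr h
        have h1 : R * (e h / r h) ≤ e h * ℓ h := by
          rw [mul_div_assoc', div_le_iff₀ hrh]
          nlinarith [hℓ h, Nat.cast_nonneg (α := ℝ) (e h)]
        nlinarith
    _ = Real.exp (-(κ * R * wt r e)) := by
        rw [← Real.exp_sum, Finset.sum_neg_distrib, ← Finset.mul_sum, wt]
    _ ≤ _ := by
        rw [Real.exp_le_exp]
        have := hF e (mem_support_iff.mp he)
        have h2 : 0 ≤ κ * R := mul_nonneg hκ hR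
        nlinarith

end Approximation

/-- Good approximations can be chosen with rapidly increasing heights. -/
lemma exists_seq_of_frequently {X : Type*} {ℓ : X → ℝ} {good : X → Prop}
    (h : ∀ x : ℝ, ∃ z, good z ∧ x ≤ ℓ z) {L K : ℝ} (hL : 0 < L) (hK : 1 ≤ K) :
    ∃ z : ℕ → X, (∀ n, good (z n)) ∧ (∀ n, L ≤ ℓ (z n)) ∧
      ∀ i j, i < j → K * ℓ (z i) ≤ ℓ (z j) := by
  choose g hg hgℓ using h
  set z : ℕ → X := fun n => Nat.rec (g L) (fun _ w => g (max L (K * ℓ w))) n with hz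
  have hsucc : ∀ n, z (n + 1) = g (max L (K * ℓ (z n))) := fun n => rfl
  have hzL : ∀ n, L ≤ ℓ (z n) := by
    intro n
    cases n with
    | zero => exact hgℓ L
    | succ n => exact (le_max_left _ _).trans (hgℓ _)
  have hstep : ∀ n, K * ℓ (z n) ≤ ℓ (z (n + 1)) := fun n => by
    rw [hsucc]
    exact (le_max_right _ _).trans (hgℓ _)
  have hmono : Monotone fun n => ℓ (z n) := monotone_nat_of_le_succ fun n =>
    (le_mul_of_one_le_left (hL.le.trans (hzL n)) hK).trans (hstep n)
  refine ⟨z, fun n => ?_, hzL, fun i j hij => (hstep i).trans (hmono hij)⟩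
  cases n with
  | zero => exact hg _
  | succ n => exact hg _

set_option maxHeartbeats 1000000 in
/-- An algebraic integer does not have arbitrarily good approximations of exponent `2 + δ`. -/
theorem not_frequently_approx {α : ℝ} (hα : IsIntegral ℤ α) {δ : ℝ} (hδ : 0 < δ) (hδ1 : δ ≤ 1)
    (h : ∀ x : ℝ, ∃ z : ℤ × ℤ, (0 < z.2 ∧ IsCoprime z.1 z.2 ∧
      |(z.1 : ℝ) / z.2 - α| ≤ Real.exp (-((2 + δ) * Real.log z.2))) ∧ x ≤ Real.log z.2) :
    False := by
  obtain ⟨B, hB, haux⟩ := exists_auxiliary hα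
  set ε := δ / 20 with hε
  have hε0 : 0 < ε := by positivity
  obtain ⟨m₀, hm₀⟩ := haux ε hε0 (by linarith)
  set m := m₀ + 1 with hm
  have hm1 : (1 : ℝ) ≤ m := by rw [hm]; push_cast; linarith [Nat.cast_nonneg (α := ℝ) m₀]
  obtain ⟨ω, hω, hroth⟩ := exists_wt_le_of_isAdmissible (Finset.univ : Finset (Fin m)) ε hε0
  set D := 2 * B * (1 + |α|) with hD
  have hα0 : 0 ≤ |α| := abs_nonneg α
  have hD1 : 1 ≤ D := by nlinarith
  have hlogB : 0 ≤ Real.log B := Real.log_nonneg hB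
  have hlogD : 0 ≤ Real.log D := Real.log_nonneg hD1
  set L := 1 + 2 / ω + 2 * m * Real.log B / ω + 2 * Real.log D / ε with hL
  have hLω : 2 / ω ≤ L := by
    rw [hL]
    have : 0 ≤ 2 * m * Real.log B / ω := by positivity
    have : 0 ≤ 2 * Real.log D / ε := by positivity
    linarith
  have hLB : 2 * m * Real.log B ≤ ω * L := by
    rw [mul_comm ω, ← div_le_iff₀ hω, hL]
    have : 0 ≤ 2 / ω := by positivity
    have : 0 ≤ 2 * Real.log D / ε := by positivity
    linarith
  have hLD : 2 * Real.log D ≤ ε * L := by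
    rw [mul_comm ε, ← div_le_iff₀ hε0, hL]
    have : 0 ≤ 2 / ω := by positivity
    have : 0 ≤ 2 * m * Real.log B / ω := by positivity
    linarith
  have hL0 : 0 < L := (by positivity : 0 < 2 / ω).trans_le hLω
  have hK : 1 ≤ 1 + 2 / ω := le_add_of_nonneg_right (by positivity)
  obtain ⟨z, hz, hzL, hzK⟩ := exists_seq_of_frequently h hL0 hK
  set p : Fin m → ℤ := fun i => (z i).1 with hp
  set q : Fin m → ℤ := fun i => (z i).2 with hq
  set ℓ : Fin m → ℝ := fun i => Real.log (q i) with hℓ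
  have hℓL : ∀ i, L ≤ ℓ i := fun i => hzL i
  have hℓ0 : ∀ i, 0 < ℓ i := fun i => hL0.trans_le (hℓL i)
  have hqpos : ∀ i, 0 < q i := fun i => (hz i).1
  set R : ℝ := ∑ i, ℓ i / ε + ∑ i, ℓ i with hR
  have hℓR : ∀ i, ℓ i ≤ R := fun i => by
    have h1 := Finset.single_le_sum (f := ℓ) (fun j _ => (hℓ0 j).le) (Finset.mem_univ i)
    have h2 : 0 ≤ ∑ i, ℓ i / ε := Finset.sum_nonneg fun j _ => div_nonneg (hℓ0 j).le hε0.le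
    linarith
  have hℓRε : ∀ i, ℓ i ≤ ε * R := fun i => by
    rw [mul_comm, ← div_le_iff₀ hε0]
    have h1 := Finset.single_le_sum (f := fun i => ℓ i / ε)
      (fun j _ => div_nonneg (hℓ0 j).le hε0.le) (Finset.mem_univ i)
    have h2 : 0 ≤ ∑ i, ℓ i := Finset.sum_nonneg fun j _ => (hℓ0 j).le
    linarith
  have hR0 : 0 < R := (hℓ0 0).trans_le (hℓR 0)
  set r : Fin m → ℕ := fun i => ⌈R / ℓ i⌉₊ with hr
  have hr0 : ∀ i, 0 < r i := fun i => Nat.ceil_pos.mpr (div_pos hR0 (hℓ0 i))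
  have hrl : ∀ i, R ≤ r i * ℓ i := fun i => (div_le_iff₀ (hℓ0 i)).mp (Nat.le_ceil _)
  have hru : ∀ i, (r i : ℝ) * ℓ i ≤ R + ℓ i := fun i => by
    have h1 : (r i : ℝ) ≤ R / ℓ i + 1 := (Nat.ceil_lt_add_one (div_pos hR0 (hℓ0 i)).le).le
    calc (r i : ℝ) * ℓ i ≤ (R / ℓ i + 1) * ℓ i := by gcongr
      _ = R + ℓ i := by rw [add_mul, div_mul_cancel₀ _ (hℓ0 i).ne', one_mul]
  have hrL : ∀ i, (r i : ℝ) * L ≤ 2 * R := fun i => by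
    have h1 := mul_le_mul_of_nonneg_left (hℓL i) (Nat.cast_nonneg (α := ℝ) (r i))
    linarith [hru i, hℓR i]
  set N := ∑ i, r i with hN
  have hNL : (N : ℝ) * L ≤ m * (2 * R) := by
    rw [hN]
    push_cast
    rw [Finset.sum_mul]
    refine (Finset.sum_le_sum fun i _ => hrL i).trans ?_
    simp
  obtain ⟨P, hP0, hPint, hPdeg, hPlen, hPord⟩ := hm₀ m (by omega) (by omega) r hr0
  have hadm : IsAdmissible ω Finset.univ r R p q P := by
    refine ⟨fun i _ => hr0 i, fun i _ => hqpos i, fun i _ => (hz i).2.1, fun i _ j _ hij => ?_,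
      fun i _ => ?_, fun i _ => hrl i, hP0, by simp, fun e he i _ => hPdeg e he i, hPint, ?_⟩
    · have h1 : (1 + 2 / ω) * ℓ i ≤ ℓ j := hzK i j hij
      have h2 : 2 / ω * ℓ i ≤ ℓ j := by linarith [hℓ0 i]
      have h3 : (r j : ℝ) * ℓ j ≤ 2 * R := by linarith [hru j, hℓR j]
      have h4 := mul_le_mul_of_nonneg_left h2 (Nat.cast_nonneg (α := ℝ) (r j))
      have h5 : (r j : ℝ) * (2 / ω * ℓ i) ≤ 2 * (r i * ℓ i) := by linarith [hrl i]
      have h6 : (r j : ℝ) * (2 / ω * ℓ i) = (r j / ω) * (2 * ℓ i) := by ring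
      have h7 : (r j / ω) * (2 * ℓ i) ≤ r i * (2 * ℓ i) := by linarith
      have h8 := le_of_mul_le_mul_right h7 (by linarith [hℓ0 i])
      rw [div_le_iff₀ hω] at h8
      linarith
    · have h1 := mul_le_mul_of_nonneg_left hLω (Nat.cast_nonneg (α := ℝ) (r i))
      have h2 : (r i : ℝ) * (2 / ω) ≤ 2 * R := h1.trans (hrL i)
      rw [mul_div_assoc', div_le_iff₀ hω] at h2
      linarith
    · refine (Real.log_le_log (len_pos hP0) hPlen).trans ?_
      rw [Real.log_pow, ← hN]
      refine le_of_mul_le_mul_right ?_ (hL0)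
      calc (N : ℝ) * Real.log B * L = N * L * Real.log B := by ring
        _ ≤ m * (2 * R) * Real.log B := by gcongr
        _ = R * (2 * m * Real.log B) := by ring
        _ ≤ R * (ω * L) := by gcongr
        _ = ω * R * L := by ring
  obtain ⟨I, hI, hIwt⟩ := hroth r R p q P hadm
  rw [coeff_shift] at hI
  set Q := hasse I P with hQ
  have hPsum : ∀ e ∈ P.support, ∑ i, e i ≤ N := fun e he =>
    Finset.sum_le_sum fun i _ => hPdeg e he i
  have hQsupp : ∀ e ∈ Q.support, e + I ∈ P.support := by
    intro e he
    rw [mem_support_iff, hQ, coeff_hasse] at he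
    exact mem_support_iff.mpr (right_ne_zero_of_mul he)
  have hQdeg : ∀ e ∈ Q.support, ∀ i, e i ≤ r i := fun e he i =>
    (Nat.le_add_right _ _).trans (hPdeg _ (hQsupp e he) i)
  have hQsum : ∀ e ∈ Q.support, ∑ i, e i ≤ N := fun e he =>
    Finset.sum_le_sum fun i _ => hQdeg e he i
  have hlow := one_le_prod_mul_abs_eval (hasse_mem_intPoly hPint I) hQdeg hqpos hI
  set F := shift (fun _ => α) Q with hF
  have hFord : OrdGE r (m * (1 / 2 - ε) - wt r I) F := by
    rw [hF, hQ, ← hasse_shift]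
    exact hPord.hasse I
  have hup := abs_eval_le_of_ordGE hr0 hFord (x := fun i => (p i : ℝ) / q i - α) (ℓ := ℓ)
    (κ := 2 + δ) (by linarith) hR0.le (fun i => (hz i).2.2) hrl
  have heval : eval (fun i => (p i : ℝ) / q i - α) F = eval (fun i => (p i : ℝ) / q i) Q := by
    rw [hF, eval_shift]
    congr 1
    congr 1
    funext i
    simp
  rw [heval] at hup
  have hFlen : len F ≤ Real.exp (ε * R * m) := by
    have h1 : len F ≤ D ^ N := by
      calc len F ≤ (1 + |α|) ^ N * len Q :=
            len_shift_le _ (by linarith) (fun _ => le_rfl) hQsum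
        _ ≤ (1 + |α|) ^ N * (2 ^ N * B ^ N) := by
            gcongr
            exact (len_hasse_le I hPsum).trans (mul_le_mul_of_nonneg_left hPlen (by positivity))
        _ = D ^ N := by rw [hD, mul_pow, mul_pow]; ring
    refine h1.trans ?_
    rw [← Real.exp_log (pow_pos (zero_lt_one.trans_le hD1) N), Real.log_pow, Real.exp_le_exp]
    refine le_of_mul_le_mul_right ?_ hL0
    calc (N : ℝ) * Real.log D * L = N * L * Real.log D := by ring
      _ ≤ m * (2 * R) * Real.log D := by gcongr
      _ = R * m * (2 * Real.log D) := by ring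
      _ ≤ R * m * (ε * L) := by gcongr
      _ = ε * R * m * L := by ring
  have hprod : ∏ i, (q i : ℝ) ^ r i ≤ Real.exp (m * ((1 + ε) * R)) := by
    have h1 : ∀ i, (q i : ℝ) ^ r i ≤ Real.exp ((1 + ε) * R) := fun i => by
      have h2 : (0 : ℝ) < q i := by exact_mod_cast hqpos i
      rw [← Real.exp_log (pow_pos h2 _), Real.log_pow, Real.exp_le_exp]
      change (r i : ℝ) * ℓ i ≤ _
      linarith [hru i, hℓRε i]
    refine (Finset.prod_le_prod (fun i _ => ?_) fun i _ => h1 i).trans ?_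
    · have h2 : (0 : ℝ) < q i := by exact_mod_cast hqpos i
      positivity
    · rw [Finset.prod_const, Finset.card_univ, Fintype.card_fin, ← Real.exp_nat_mul]
  have hfin : 1 ≤ Real.exp (m * ((1 + ε) * R)) *
      (Real.exp (ε * R * m) * Real.exp (-((2 + δ) * R * (m * (1 / 2 - ε) - wt r I)))) := by
    refine hlow.trans (mul_le_mul hprod (hup.trans ?_) (abs_nonneg _) (Real.exp_pos _).le)
    exact mul_le_mul_of_nonneg_right hFlen (Real.exp_pos _).le
  rw [← Real.exp_add, ← Real.exp_add, Real.one_le_exp_iff] at hfin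
  have h1 : m * (1 / 2 - 2 * ε) ≤ m * (1 / 2 - ε) - wt r I := by nlinarith
  have h2 : (2 + δ) * R * (m * (1 / 2 - 2 * ε)) ≤
      (2 + δ) * R * (m * (1 / 2 - ε) - wt r I) :=
    mul_le_mul_of_nonneg_left h1 (by positivity)
  have h3 : 0 ≤ R * m * (1 + 2 * ε - (2 + δ) * (1 / 2 - 2 * ε)) := by linarith
  have hRm : 0 < R * m := by positivity
  have h4 := nonneg_of_mul_nonneg_right h3 hRm
  nlinarith

end RothTheorem

/-- Roth's theorem: an irrational algebraic real number is badly
approximable by rationals to any exponent greater than 2. -/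
theorem stmt2 (α : ℝ) (hirr : Irrational α) (halg : IsAlgebraic ℚ α) :
    ∀ δ : ℝ, 0 < δ → ∃ C : ℝ, 0 < C ∧
      ∀ q : ℤ, q ≠ 0 → ∀ p : ℤ, |(q : ℝ) * α - p| > C * (|(q : ℝ)|) ^ (-(1 + δ)) := by
  intro δ hδ
  by_contra! hcon
  obtain ⟨a, ha, hint⟩ := ((IsFractionRing.isAlgebraic_iff ℤ ℚ ℝ).mpr halg).exists_integral_multiple
  rw [zsmul_eq_mul] at hint
  have hγ : Irrational ((a : ℝ) * α) := hirr.intCast_mul ha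
  have ha0 : 0 < |(a : ℝ)| := abs_pos.mpr (by exact_mod_cast ha)
  refine RothTheorem.not_frequently_approx hint (lt_min hδ one_pos) (min_le_right δ 1) fun x => ?_
  have hev := hγ.eventually_forall_le_dist_cast_div_of_denom_le ⌈exp x⌉₊
  obtain ⟨c, hc, hc0⟩ := ((hev.filter_mono nhdsWithin_le_nhds).and
    (self_mem_nhdsWithin : Set.Ioi (0 : ℝ) ∈ nhdsWithin 0 (Set.Ioi 0))).exists
  replace hc0 : 0 < c := hc0
  have hC0 : 0 < min 1 (c / 2) := lt_min one_pos (half_pos hc0)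
  obtain ⟨q, hq, p, hpq⟩ := hcon (min 1 (c / 2) / |(a : ℝ)|) (div_pos hC0 ha0)
  have hq1 : 1 ≤ |(q : ℝ)| := by exact_mod_cast Int.one_le_abs hq
  have hq0 : (q : ℝ) ≠ 0 := by exact_mod_cast hq
  have hqpos : 0 < |(q : ℝ)| := abs_pos.mpr hq0
  set s : ℚ := ((a * p : ℤ) : ℚ) / (q : ℤ) with hs
  have hsR : (s.num : ℝ) / (s.den : ℝ) = a * p / q := by
    rw [← Rat.cast_def, hs]
    push_cast
    rfl
  have hden : (s.den : ℝ) ≤ |(q : ℝ)| := by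
    have h1 : (s.den : ℤ) ∣ q := by
      rw [hs, ← Rat.divInt_eq_div]
      exact Rat.den_dvd _ _
    have h2 := Int.le_of_dvd (abs_pos.mpr hq) ((dvd_abs _ _).mpr h1)
    exact_mod_cast h2
  have hden1 : (1 : ℝ) ≤ s.den := by exact_mod_cast s.pos
  have hden0 : (0 : ℝ) < s.den := by linarith
  have hdist : |(s.num : ℝ) / s.den - a * α| ≤ min 1 (c / 2) * |(q : ℝ)| ^ (-(2 + δ)) := by
    have h1 : (s.num : ℝ) / s.den - a * α = -(a * (q * α - p) / q) := by
      rw [hsR]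
      field_simp
      ring
    rw [h1, abs_neg, abs_div, abs_mul, div_le_iff₀ hqpos]
    calc |(a : ℝ)| * |q * α - p| ≤ |(a : ℝ)| * (min 1 (c / 2) / |(a : ℝ)| *
          |(q : ℝ)| ^ (-(1 + δ))) := by gcongr
      _ = min 1 (c / 2) * |(q : ℝ)| ^ (-(2 + δ) + 1) := by
          rw [show -(2 + δ) + 1 = -(1 + δ) by ring]
          field_simp
      _ = min 1 (c / 2) * |(q : ℝ)| ^ (-(2 + δ)) * |(q : ℝ)| := by
          rw [rpow_add_one hqpos.ne', mul_assoc]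
  have hpow : |(q : ℝ)| ^ (-(2 + δ)) ≤ exp (-((2 + min δ 1) * log s.den)) := by
    rw [rpow_def_of_pos hqpos, exp_le_exp, mul_comm, neg_mul, neg_le_neg_iff]
    have h1 : log s.den ≤ log |(q : ℝ)| := log_le_log hden0 hden
    have h2 : 0 ≤ log (s.den : ℝ) := log_nonneg hden1
    gcongr
    exact min_le_left _ _
  refine ⟨(s.num, s.den), ⟨Int.natCast_pos.mpr s.pos, ?_, ?_⟩, ?_⟩
  · exact Int.isCoprime_iff_nat_coprime.mpr (by simpa using s.reduced)
  · push_cast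
    refine hdist.trans (le_trans ?_ hpow)
    exact mul_le_of_le_one_left (rpow_nonneg hqpos.le _) (min_le_left _ _)
  · push_cast
    rw [le_log_iff_exp_le hden0]
    by_contra! hlt
    have h1 : s.den ≤ ⌈exp x⌉₊ := by
      exact_mod_cast hlt.le.trans (Nat.le_ceil _)
    have h2 := hc s.den h1 s.num
    rw [dist_comm, Real.dist_eq] at h2
    have h3 : |(q : ℝ)| ^ (-(2 + δ)) ≤ 1 := rpow_le_one_of_one_le_of_nonpos hq1 (by linarith)
    have h4 : min 1 (c / 2) * |(q : ℝ)| ^ (-(2 + δ)) ≤ min 1 (c / 2) :=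
      mul_le_of_le_one_right hC0.le h3
    linarith [min_le_right (1 : ℝ) (c / 2)]
end

section
/- Fix α ∈ ℝ, constants C > 0 and 0 < δ < ε, and suppose α is (C, 1+δ)-Diophantine. Then for every function p : ℤ⁺ → ℤ, the series ∑_{l=1}^{∞} 1/(l^{1+ε} · |lα − p(l)|) converges. -/
open Real

/-- The integer part of a real number of absolute value at least `1` is nonzero and at most twice
as large in absolute value. -/
theorem floor_ne_zero_and_abs_floor_le {y : ℝ} (hy : 1 ≤ |y|) :
    ⌊y⌋ ≠ 0 ∧ |(⌊y⌋ : ℝ)| ≤ 2 * |y| := by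
  have h1 := Int.floor_le y
  have h2 := Int.lt_floor_add_one y
  rcases le_abs.mp hy with h | h
  · have hm : 1 ≤ ⌊y⌋ := Int.le_floor.mpr (by simpa using h)
    have hm' : (1 : ℝ) ≤ ⌊y⌋ := by exact_mod_cast hm
    refine ⟨by omega, ?_⟩
    rw [abs_of_pos (by linarith), abs_of_pos (by linarith)]
    linarith
  · have hm : ⌊y⌋ < 0 := Int.floor_lt.mpr (by push_cast; linarith)
    have hm' : (⌊y⌋ : ℝ) < 0 := by exact_mod_cast hm
    refine ⟨hm.ne, ?_⟩
    rw [abs_of_neg hm', abs_of_neg (by linarith)]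
    linarith

/-- Interpolation bound for the reciprocal: small `t` are controlled by the first summand,
large `t` by the second. -/
theorem one_div_le_rpow_mul_rpow_add_one_div {t N η : ℝ} (ht : 0 < t) (hN : 0 < N) (hη : 0 < η) :
    1 / t ≤ N ^ η * t ^ (-(1 + η)) + 1 / N := by
  rcases le_total t N with h | h
  · have h1 : 1 / t = t ^ η * t ^ (-(1 + η)) := by
      rw [← rpow_add ht, show η + -(1 + η) = -1 by ring, rpow_neg_one, one_div]
    have h2 : t ^ η ≤ N ^ η := rpow_le_rpow ht.le h hη.le
    have h3 : t ^ η * t ^ (-(1 + η)) ≤ N ^ η * t ^ (-(1 + η)) := by gcongr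
    have h4 : 0 < 1 / N := by positivity
    linarith
  · have h1 : 1 / t ≤ 1 / N := one_div_le_one_div_of_le hN h
    have h2 : 0 ≤ N ^ η * t ^ (-(1 + η)) := by positivity
    linarith

/-- Sum of reciprocals of at most `N` reals that are `d`-separated from each other and from `0`. -/
theorem sum_one_div_abs_le_of_separated {ι : Type*} (s : Finset ι) (x : ι → ℝ) {d N η : ℝ}
    (hd : 0 < d) (hN : 0 < N) (hη : 0 < η) (hcard : (s.card : ℝ) ≤ N)
    (hx : ∀ i ∈ s, d ≤ |x i|) (hsep : ∀ i ∈ s, ∀ j ∈ s, i ≠ j → d ≤ |x i - x j|) :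
    ∑ i ∈ s, 1 / |x i| ≤ 2 / d * (N ^ η * (∑' m : ℤ, |(m : ℝ)| ^ (-(1 + η))) + 1) := by
  have hinj : Set.InjOn (fun i => ⌊x i / d⌋) (s : Set ι) := by
    intro i hi j hj hij
    by_contra hne
    have h1 := Int.abs_sub_lt_one_of_floor_eq_floor hij
    rw [← sub_div, abs_div, abs_of_pos hd, div_lt_one hd] at h1
    exact absurd (hsep i hi j hj hne) (not_le.mpr h1)
  have hterm : ∀ i ∈ s, 1 / |x i| ≤
      2 / d * (N ^ η * |(⌊x i / d⌋ : ℝ)| ^ (-(1 + η)) + 1 / N) := by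
    intro i hi
    have hxi := hx i hi
    have hy : 1 ≤ |x i / d| := by
      rw [abs_div, abs_of_pos hd, one_le_div hd]
      exact hxi
    obtain ⟨h0, h2⟩ := floor_ne_zero_and_abs_floor_le hy
    have hpos : 0 < |(⌊x i / d⌋ : ℝ)| := abs_pos.mpr (by exact_mod_cast h0)
    have hle : 1 / |x i| ≤ 2 / d * (1 / |(⌊x i / d⌋ : ℝ)|) := by
      rw [abs_div, abs_of_pos hd] at h2
      have hxp : 0 < |x i| := hd.trans_le hxi
      rw [div_mul_div_comm, div_le_div_iff₀ hxp (by positivity)]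
      calc 1 * (d * |(⌊x i / d⌋ : ℝ)|) ≤ 1 * (d * (2 * (|x i| / d))) := by gcongr
        _ = 2 * 1 * |x i| := by field_simp
    refine hle.trans ?_
    gcongr
    exact one_div_le_rpow_mul_rpow_add_one_div hpos hN hη
  have hsum : Summable fun m : ℤ => |(m : ℝ)| ^ (-(1 + η)) :=
    Real.summable_abs_int_rpow (by linarith)
  refine (Finset.sum_le_sum hterm).trans ?_
  rw [← Finset.mul_sum, Finset.sum_add_distrib, ← Finset.mul_sum, Finset.sum_const, nsmul_eq_mul]
  gcongr
  · rw [← Finset.sum_image (f := fun m : ℤ => |(m : ℝ)| ^ (-(1 + η))) hinj]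
    exact hsum.sum_le_tsum _ fun _ _ => by positivity
  · rw [mul_one_div, div_le_one hN]
    exact hcard

/-- Bound for the part of Arnold's series over a block `N / 2 ≤ l < N`. -/
theorem sum_block_le_of_diophantine {α C δ ε : ℝ} (hC : 0 < C) (hδ : 0 < δ) (hδε : δ < ε)
    (hdio : ∀ q : ℤ, q ≠ 0 → ∀ p : ℤ, |(q : ℝ) * α - p| > C * (|(q : ℝ)|) ^ (-(1 + δ)))
    (p : ℕ+ → ℤ) (N : ℕ) (hN : 1 ≤ N) (s : Finset ℕ+)
    (hs : ∀ l ∈ s, (N : ℝ) / 2 ≤ (l : ℝ) ∧ (l : ℕ) < N) :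
    ∑ l ∈ s, 1 / ((l : ℝ) ^ (1 + ε) * |(l : ℝ) * α - p l|) ≤
      2 ^ (1 + ε) * (2 / C) * ((∑' m : ℤ, |(m : ℝ)| ^ (-(1 + (ε - δ) / 2))) + 1) *
        (N : ℝ) ^ (-((ε - δ) / 2)) := by
  set η := (ε - δ) / 2 with hη_def
  set S := ∑' m : ℤ, |(m : ℝ)| ^ (-(1 + η))
  have hη : 0 < η := by rw [hη_def]; linarith
  have hN1 : (1 : ℝ) ≤ N := by exact_mod_cast hN
  have hN0 : (0 : ℝ) < N := by linarith
  have hd : 0 < C * (N : ℝ) ^ (-(1 + δ)) := by positivity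
  have hlower : ∀ q : ℤ, q ≠ 0 → |q| ≤ N → ∀ r : ℤ,
      C * (N : ℝ) ^ (-(1 + δ)) ≤ |(q : ℝ) * α - r| := by
    intro q hq hqN r
    refine le_trans ?_ (hdio q hq r).le
    have hq' : 0 < |(q : ℝ)| := abs_pos.mpr (by exact_mod_cast hq)
    have hqN' : |(q : ℝ)| ≤ N := by exact_mod_cast hqN
    have := rpow_le_rpow_of_nonpos hq' hqN' (by linarith : -(1 + δ) ≤ 0)
    gcongr
  have hcard : (s.card : ℝ) ≤ N := by
    have : s.card ≤ (Finset.range N).card :=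
      Finset.card_le_card_of_injOn (fun l => (l : ℕ))
        (fun l hl => by simpa using (hs l hl).2) (fun _ _ _ _ h => PNat.coe_injective h)
    rw [Finset.card_range] at this
    exact_mod_cast this
  have hsep := sum_one_div_abs_le_of_separated s (fun l : ℕ+ => (l : ℝ) * α - p l) hd hN0 hη hcard
    (fun l hl => by
      have h2 := (hs l hl).2
      have h0 := l.pos
      have := hlower ((l : ℕ) : ℤ) (by omega) (by rw [abs_of_nonneg (by omega)]; omega) (p l)
      simpa using this)
    (fun i hi j hj hij => by
      have h1 := (hs i hi).2
      have h2 := (hs j hj).2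
      have hne : (i : ℕ) ≠ j := fun h => hij (PNat.coe_injective h)
      have := hlower ((i : ℕ) - (j : ℕ) : ℤ) (by omega) (by rw [abs_le]; omega) (p i - p j)
      convert this using 2
      push_cast
      ring)
  have hS : 0 ≤ S := tsum_nonneg fun _ => by positivity
  have hNη : 1 ≤ (N : ℝ) ^ η := one_le_rpow hN1 hη.le
  calc ∑ l ∈ s, 1 / ((l : ℝ) ^ (1 + ε) * |(l : ℝ) * α - p l|)
      ≤ ∑ l ∈ s, 1 / ((N : ℝ) / 2) ^ (1 + ε) * (1 / |(l : ℝ) * α - p l|) := by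
        refine Finset.sum_le_sum fun l hl => ?_
        rw [← one_div_mul_one_div]
        gcongr
        · linarith
        · exact (hs l hl).1
    _ = 1 / ((N : ℝ) / 2) ^ (1 + ε) * ∑ l ∈ s, 1 / |(l : ℝ) * α - p l| := by
        rw [Finset.mul_sum]
    _ ≤ 1 / ((N : ℝ) / 2) ^ (1 + ε) *
          (2 / (C * (N : ℝ) ^ (-(1 + δ))) * ((N : ℝ) ^ η * (S + 1))) := by
        gcongr
        refine hsep.trans ?_
        gcongr
        linarith
    _ = 2 ^ (1 + ε) * (2 / C) * (S + 1) * (N : ℝ) ^ (-η) := by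
        have h1 : (N : ℝ) ^ (-η) = (N : ℝ) ^ (1 + δ) * (N : ℝ) ^ η / (N : ℝ) ^ (1 + ε) := by
          rw [← rpow_add hN0, ← rpow_sub hN0]
          congr 1
          rw [hη_def]
          ring
        rw [h1, div_rpow hN0.le two_pos.le, rpow_neg hN0.le]
        field_simp

/-- Arnold's small denominator lemma: if `α` is `(C, 1+δ)`-Diophantine and
`0 < δ < ε`, then for any choice `p : ℤ⁺ → ℤ` of numerators, the series
`∑_{l=1}^∞ 1/(l^{1+ε} |lα − p(l)|)` converges. -/
theorem stmt3 (α : ℝ) (C δ ε : ℝ) (hC : 0 < C) (hδ : 0 < δ) (hδε : δ < ε)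
    (hdio : ∀ q : ℤ, q ≠ 0 → ∀ p : ℤ, |(q : ℝ) * α - p| > C * (|(q : ℝ)|) ^ (-(1 + δ))) :
    ∀ p : ℕ+ → ℤ,
      Summable (fun l : ℕ+ => 1 / ((l : ℝ) ^ (1 + ε) * |(l : ℝ) * α - p l|)) := by
  intro p
  set η := (ε - δ) / 2 with hη_def
  have hη : 0 < η := by rw [hη_def]; linarith
  set K := 2 ^ (1 + ε) * (2 / C) * ((∑' m : ℤ, |(m : ℝ)| ^ (-(1 + η))) + 1)
  have hK : 0 ≤ K := by
    have : 0 ≤ ∑' m : ℤ, |(m : ℝ)| ^ (-(1 + η)) := tsum_nonneg fun _ => by positivity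
    positivity
  have hgeom : Summable fun k : ℕ => K * (((2 ^ (k + 1) : ℕ) : ℝ) ^ (-η)) := by
    have hr : (2 : ℝ) ^ (-η) < 1 := rpow_lt_one_of_one_lt_of_neg one_lt_two (by linarith)
    have hsum := (summable_nat_add_iff 1).mpr
      (summable_geometric_of_lt_one (by positivity : (0 : ℝ) ≤ 2 ^ (-η)) hr)
    refine (hsum.mul_left K).congr fun k => ?_
    rw [Nat.cast_pow, Nat.cast_ofNat, rpow_pow_comm two_pos.le]
  refine summable_of_sum_le (fun l => by positivity)
    (c := ∑' k : ℕ, K * (((2 ^ (k + 1) : ℕ) : ℝ) ^ (-η))) fun u => ?_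
  rw [← Finset.sum_fiberwise_of_maps_to (t := u.image fun l : ℕ+ => Nat.log 2 l)
    (fun l hl => Finset.mem_image_of_mem (fun l : ℕ+ => Nat.log 2 l) hl)]
  refine (Finset.sum_le_sum fun k _ => ?_).trans
    (hgeom.sum_le_tsum _ fun k _ => by positivity)
  refine sum_block_le_of_diophantine hC hδ hδε hdio p (2 ^ (k + 1)) Nat.one_le_two_pow _
    fun l hl => ?_
  obtain rfl := (Finset.mem_filter.mp hl).2
  refine ⟨?_, Nat.lt_pow_succ_log_self one_lt_two _⟩
  have h : ((2 ^ Nat.log 2 (l : ℕ) : ℕ) : ℝ) ≤ ((l : ℕ) : ℝ) :=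
    Nat.cast_le.mpr (Nat.pow_log_le_self 2 l.pos.ne')
  rw [pow_succ]
  push_cast at h ⊢
  linarith
end
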